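/- Let Δ be a simplicial complex on [n] and let J(Δ) = ∩_{F a facet of Δ} P_F be its cover ideal. The following conditions are equivalent: (i) J(Δ)^{(m)} is Cohen–Macaulay for every m ≥ 1; (ii) J(Δ)^{(m)} is Cohen–Macaulay for some m ≥ 3; (iii) Δ is a matroid. -/

import Mathlib

open CategoryTheory Opposite

/-! ### Abstract simplicial complexes -/

/-- An abstract simplicial complex on the vertex set `Fin n`: a collection of finite
subsets (faces) closed under taking subsets. -/
structure SimComplex (n : ℕ) where
  faces : Set (Finset (Fin n))
  down_closed : ∀ ⦃F G : Finset (Fin n)⦄, F ∈ faces → G ⊆ F → G ∈ faces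

namespace SimComplex

variable {n : ℕ}

/-- The vertex set of a simplicial complex. -/
def vertexSet (Δ : SimComplex n) : Set (Fin n) := {v | ({v} : Finset (Fin n)) ∈ Δ.faces}

/-- The dimension of a simplicial complex: the maximal cardinality of a face, minus one. -/
noncomputable def dim (Δ : SimComplex n) : ℤ :=
  (Int.ofNat (sSup (Finset.card '' Δ.faces))) - 1

/-- A facet is a maximal face. -/
def IsFacet (Δ : SimComplex n) (F : Finset (Fin n)) : Prop :=
  F ∈ Δ.faces ∧ ∀ G ∈ Δ.faces, F ⊆ G → F = G

/-- A complex is pure if all facets have the same cardinality. -/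
def Pure (Δ : SimComplex n) : Prop :=
  ∀ F G, Δ.IsFacet F → Δ.IsFacet G → F.card = G.card

/-- A matroid: for any two faces `F`, `G` with `|F| > |G|` there is `i ∈ F ∖ G`
with `G ∪ {i}` a face. -/
def IsMatroid (Δ : SimComplex n) : Prop :=
  ∀ F G, F ∈ Δ.faces → G ∈ Δ.faces → G.card < F.card →
    ∃ i ∈ F, i ∉ G ∧ insert i G ∈ Δ.faces

/-- The link of a face `G`: `{F ∖ G : G ⊆ F ∈ Δ}`. -/
def link (Δ : SimComplex n) (G : Finset (Fin n)) : SimComplex n where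
  faces := {F | Disjoint F G ∧ F ∪ G ∈ Δ.faces}
  down_closed := by
    intro F F' hF hsub
    exact ⟨hF.1.mono_left hsub, Δ.down_closed hF.2 (Finset.union_subset_union hsub subset_rfl)⟩

/-- The star of a face `G`: `{F ∈ Δ : F ∪ G ∈ Δ}`. -/
def star (Δ : SimComplex n) (G : Finset (Fin n)) : SimComplex n where
  faces := {F | F ∈ Δ.faces ∧ F ∪ G ∈ Δ.faces}
  down_closed := by
    intro F F' hF hsub
    exact ⟨Δ.down_closed hF.1 hsub, Δ.down_closed hF.2 (Finset.union_subset_union hsub subset_rfl)⟩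

/-- `Δ` is locally a matroid if the link of every vertex is a matroid. -/
def LocallyMatroid (Δ : SimComplex n) : Prop :=
  ∀ v ∈ Δ.vertexSet, (Δ.link {v}).IsMatroid

/-- Two vertices are adjacent if they span a 1-dimensional face (an edge). -/
def Adj (Δ : SimComplex n) (u v : Fin n) : Prop :=
  u ≠ v ∧ ({u, v} : Finset (Fin n)) ∈ Δ.faces

/-- Two vertices are joined by a path of edges. -/
def Reach (Δ : SimComplex n) : Fin n → Fin n → Prop := Relation.ReflTransGen Δ.Adj

/-- A complex is connected if any two vertices are joined by a path of edges. -/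
def Connected (Δ : SimComplex n) : Prop :=
  ∀ u ∈ Δ.vertexSet, ∀ v ∈ Δ.vertexSet, Δ.Reach u v

/-- The induced subcomplex on a set `W` of vertices. -/
def induced (Δ : SimComplex n) (W : Set (Fin n)) : SimComplex n where
  faces := {F | F ∈ Δ.faces ∧ ↑F ⊆ W}
  down_closed := by
    intro F F' hF hsub
    exact ⟨Δ.down_closed hF.1 hsub, subset_trans (Finset.coe_subset.2 hsub) hF.2⟩

/-- The connected component of a vertex `v`, as an induced subcomplex. -/
def component (Δ : SimComplex n) (v : Fin n) : SimComplex n :=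
  Δ.induced {u | Δ.Reach v u}

/-- A minimal nonface: a subset of the vertex set which is not a face, all of whose
proper subsets are faces. -/
def IsMinNonface (Δ : SimComplex n) (F : Finset (Fin n)) : Prop :=
  ↑F ⊆ Δ.vertexSet ∧ F ∉ Δ.faces ∧ ∀ G ⊂ F, G ∈ Δ.faces

/-- A complete intersection complex: the minimal nonfaces are pairwise disjoint. -/
def IsCompleteIntersection (Δ : SimComplex n) : Prop :=
  ∀ F G, Δ.IsMinNonface F → Δ.IsMinNonface G → F ≠ G → Disjoint F G

/-- `Δ` is locally a complete intersection if the link of every vertex is one. -/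
def LocallyCompleteIntersection (Δ : SimComplex n) : Prop :=
  ∀ v ∈ Δ.vertexSet, (Δ.link {v}).IsCompleteIntersection

/-- A path graph: vertices `f 0, …, f (k+1)` and edges exactly the consecutive pairs. -/
def IsPathGraph (Δ : SimComplex n) : Prop :=
  ∃ (k : ℕ) (f : Fin (k + 2) → Fin n), Function.Injective f ∧
    Δ.vertexSet = Set.range f ∧
    ∀ e : Finset (Fin n), (e ∈ Δ.faces ∧ e.card = 2) ↔
      ∃ i : Fin (k + 1), e = {f i.castSucc, f i.succ}

/-- A cycle graph: vertices `f 0, …, f (k+2)` and edges exactly the cyclically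
consecutive pairs. -/
def IsCycleGraph (Δ : SimComplex n) : Prop :=
  ∃ (k : ℕ) (f : Fin (k + 3) → Fin n), Function.Injective f ∧
    Δ.vertexSet = Set.range f ∧
    ∀ e : Finset (Fin n), (e ∈ Δ.faces ∧ e.card = 2) ↔
      ∃ i : Fin (k + 3), e = {f i, f (i + 1)}

end SimComplex

/-! ### Commutative-algebra notions -/

noncomputable section

/-- The `i`-th Ext group of two modules over a commutative ring. -/
def ExtGroup (A : Type) [CommRing A] (i : ℕ) (M N : Type) [AddCommGroup M] [Module A M]
    [AddCommGroup N] [Module A N] : Type :=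
  ((Ext A (ModuleCat A) i).obj (op (ModuleCat.of A M))).obj (ModuleCat.of A N)

/-- A local ring is Cohen–Macaulay if its depth equals its Krull dimension, i.e. if
`Ext^i(residue field, B)` vanishes for all `i < dim B`. -/
def IsCohenMacaulayLocalRing (B : Type) [CommRing B] [IsLocalRing B] : Prop :=
  ∀ i : ℕ, (i : WithBot ℕ∞) < ringKrullDim B →
    Subsingleton (ExtGroup B i (B ⧸ IsLocalRing.maximalIdeal B) B)

/-- A commutative ring is Cohen–Macaulay if all its localizations at primes are
Cohen–Macaulay local rings. -/
def IsCohenMacaulayRing (A : Type) [CommRing A] : Prop :=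
  ∀ (P : Ideal A) (hP : P.IsPrime),
    letI : P.IsPrime := hP
    IsCohenMacaulayLocalRing (Localization.AtPrime P)

/-- An ideal `I` of `A` is Cohen–Macaulay if `A ⧸ I` is a Cohen–Macaulay ring. -/
def IsCohenMacaulayIdeal {A : Type} [CommRing A] (I : Ideal A) : Prop :=
  IsCohenMacaulayRing (A ⧸ I)

/-- The ideal `I` satisfies Serre's condition `(S₂)`: for every prime `P` of `A`, the
depth of the localized module `(A⧸I)_P` over `A_P` is at least `min {2, height P}`,
where the height of `P` is the Krull dimension of `A_P` and depth is detected by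
vanishing of `Ext^i` from the residue field. -/
def SatisfiesS2 {A : Type} [CommRing A] (I : Ideal A) : Prop :=
  ∀ (P : Ideal A) (hP : P.IsPrime),
    letI : P.IsPrime := hP
    ∀ i : ℕ, (i : WithBot ℕ∞) < min 2 (ringKrullDim (Localization.AtPrime P)) →
      Subsingleton (ExtGroup (Localization.AtPrime P) i
        (Localization.AtPrime P ⧸ IsLocalRing.maximalIdeal (Localization.AtPrime P))
        (LocalizedModule P.primeCompl (A ⧸ I)))

/-- The `m`-th symbolic power of an ideal: the intersection of the `m`-th powers of
its minimal primes. -/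
def symbPowIdeal {A : Type} [CommRing A] (I : Ideal A) (m : ℕ) : Ideal A :=
  ⨅ P ∈ I.minimalPrimes, P ^ m

end

/-! ### Stanley–Reisner theory -/

noncomputable section

open MvPolynomial

/-- The squarefree monomial attached to a finite set of variables. -/
def faceMonomial (K : Type) [Field K] {n : ℕ} (F : Finset (Fin n)) : MvPolynomial (Fin n) K :=
  ∏ i ∈ F, X i

/-- The Stanley–Reisner ideal of a complex on `[n]`: generated by the squarefree
monomials corresponding to nonfaces. -/
def SRIdeal (K : Type) [Field K] {n : ℕ} (Δ : SimComplex n) : Ideal (MvPolynomial (Fin n) K) :=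
  Ideal.span {p | ∃ F : Finset (Fin n), F ∉ Δ.faces ∧ p = faceMonomial K F}

/-- The Stanley–Reisner ideal of a complex whose vertex set may be a proper subset of
`[n]`: generated by the squarefree monomials of nonfaces contained in the vertex set. -/
def SRIdealOn (K : Type) [Field K] {n : ℕ} (Δ : SimComplex n) : Ideal (MvPolynomial (Fin n) K) :=
  Ideal.span {p | ∃ F : Finset (Fin n), ↑F ⊆ Δ.vertexSet ∧ F ∉ Δ.faces ∧ p = faceMonomial K F}

/-- The prime ideal generated by the variables indexed by `F`. -/
def PF (K : Type) [Field K] {n : ℕ} (F : Finset (Fin n)) : Ideal (MvPolynomial (Fin n) K) :=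
  Ideal.span ((fun i => (X i : MvPolynomial (Fin n) K)) '' ↑F)

/-- The `m`-th symbolic power of the Stanley–Reisner ideal:
`I_Δ^{(m)} = ⋂_{F facet} P_{complement of F}^m`. -/
def SRSymbPow (K : Type) [Field K] {n : ℕ} (Δ : SimComplex n) (m : ℕ) :
    Ideal (MvPolynomial (Fin n) K) :=
  ⨅ (F : Finset (Fin n)) (_ : Δ.IsFacet F), (PF K Fᶜ) ^ m

/-- The cover ideal `J(Δ) = ⋂_{F facet} P_F` and its symbolic powers. -/
def coverSymbPow (K : Type) [Field K] {n : ℕ} (Δ : SimComplex n) (m : ℕ) :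
    Ideal (MvPolynomial (Fin n) K) :=
  ⨅ (F : Finset (Fin n)) (_ : Δ.IsFacet F), (PF K F) ^ m

/-- The graded maximal ideal `(x_1, …, x_n)`. -/
def maxIdeal (K : Type) [Field K] (n : ℕ) : Ideal (MvPolynomial (Fin n) K) :=
  Ideal.span (Set.range X)

/-- The `i`-th local cohomology module of `S ⧸ I` with support in the maximal
graded ideal. -/
def locCoh (K : Type) [Field K] {n : ℕ} (i : ℕ) (I : Ideal (MvPolynomial (Fin n) K)) :
    ModuleCat (MvPolynomial (Fin n) K) :=
  (localCohomology (maxIdeal K n) i).obj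
    (ModuleCat.of (MvPolynomial (Fin n) K) (MvPolynomial (Fin n) K ⧸ I))

/-- `I` is quasi-Buchsbaum: the maximal ideal annihilates all local cohomology modules
`H^i_m(S⧸I)` for `i < dim S⧸I`. -/
def IsQuasiBuchsbaum (K : Type) [Field K] {n : ℕ} (I : Ideal (MvPolynomial (Fin n) K)) : Prop :=
  ∀ i : ℕ, (i : WithBot ℕ∞) < ringKrullDim (MvPolynomial (Fin n) K ⧸ I) →
    ∀ x ∈ maxIdeal K n, ∀ y : (locCoh K i I), x • y = 0

/-- `I` is Buchsbaum: for `i < dim S⧸I` the natural map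
`Ext^i_S(S⧸m, S⧸I) → H^i_m(S⧸I)` (the structure map into the direct limit defining local
cohomology) is surjective. -/
def IsBuchsbaum (K : Type) [Field K] {n : ℕ} (I : Ideal (MvPolynomial (Fin n) K)) : Prop :=
  ∀ i : ℕ, (i : WithBot ℕ∞) < ringKrullDim (MvPolynomial (Fin n) K ⧸ I) →
    letI := localCohomology.hasColimitDiagram
      (localCohomology.idealPowersDiagram (maxIdeal K n)) i
    Function.Surjective
      ((CategoryTheory.Limits.colimit.ι
          (localCohomology.diagram (localCohomology.idealPowersDiagram (maxIdeal K n)) i)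
          (Opposite.op (Opposite.op (1 : ℕ)))).app
        (ModuleCat.of (MvPolynomial (Fin n) K) (MvPolynomial (Fin n) K ⧸ I)))

/-- `I` is generalized Cohen–Macaulay: the local cohomology modules `H^i_m(S⧸I)` are
finite-dimensional over `K` for `i < dim S⧸I`. -/
def IsGeneralizedCM (K : Type) [Field K] {n : ℕ} (I : Ideal (MvPolynomial (Fin n) K)) : Prop :=
  ∀ i : ℕ, (i : WithBot ℕ∞) < ringKrullDim (MvPolynomial (Fin n) K ⧸ I) →
    Module.Finite K (RestrictScalars K (MvPolynomial (Fin n) K) (locCoh K i I))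

end

/-! ### Monomial ideals -/

/-- A monomial ideal of `K[x_1,…,x_n]`. -/
def IsMonomialIdeal {K : Type} [Field K] {n : ℕ} (I : Ideal (MvPolynomial (Fin n) K)) : Prop :=
  ∃ S : Set (Fin n →₀ ℕ),
    I = Ideal.span {p | ∃ d ∈ S, p = MvPolynomial.monomial d (1 : K)}

/-- A squarefree monomial ideal of `K[x_1,…,x_n]`. -/
def IsSquarefreeMonomialIdeal {K : Type} [Field K] {n : ℕ}
    (I : Ideal (MvPolynomial (Fin n) K)) : Prop :=
  ∃ S : Set (Finset (Fin n)),
    I = Ideal.span {p | ∃ F ∈ S, p = ∏ i ∈ F, (MvPolynomial.X i : MvPolynomial (Fin n) K)}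


theorem oldExt_subsingleton_iff (A : Type) [CommRing A] (i : ℕ) (X Y : ModuleCat.{0} A) :
    Subsingleton (((Ext A (ModuleCat A) i).obj (op X)).obj Y) ↔
      Subsingleton (Abelian.Ext X Y i) := by
  let P := projectiveResolution X
  have e := P.isoExt (R := A) i Y
  have h1 : Subsingleton (((Ext A (ModuleCat A) i).obj (op X)).obj Y) ↔
      (P.complex.linearYonedaObj A Y).ExactAt i := by
    rw [HomologicalComplex.exactAt_iff_isZero_homology, ← ModuleCat.isZero_iff_subsingleton]
    exact ⟨fun h => h.of_iso e.symm, fun h => h.of_iso e⟩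
  rw [h1]
  cases i with
  | zero =>
    rw [HomologicalComplex.exactAt_iff' _ 0 0 1 (by simp) (by simp), ShortComplex.moduleCat_exact_iff]
    have h2 : Subsingleton (Abelian.Ext X Y 0) ↔ Subsingleton (X ⟶ Y) :=
      Abelian.Ext.addEquiv₀.subsingleton_congr
    rw [h2]
    have hep : Epi (ShortComplex.mk _ _ P.complex_d_comp_π_f_zero).g :=
      inferInstanceAs (Epi (P.π.f 0))
    constructor
    · intro h
      refine subsingleton_of_forall_eq 0 fun α => ?_
      obtain ⟨g, hg⟩ := h (P.π.f 0 ≫ (show ((ChainComplex.single₀ (ModuleCat A)).obj X).X 0 ⟶ Y from α)) (by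
        change P.complex.d 1 0 ≫ _ = 0
        rw [← Category.assoc, P.complex_d_comp_π_f_zero, Limits.zero_comp])
      have this : P.complex.d 0 0 = 0 := P.complex.shape _ _ (by simp)
      have key : ∀ g : P.complex.X 0 ⟶ Y, P.complex.d 0 0 ≫ g = 0 := fun g => by
        rw [this, Limits.zero_comp]
      have hg' : 0 = P.π.f 0 ≫ (show ((ChainComplex.single₀ (ModuleCat A)).obj X).X 0 ⟶ Y from α) :=
        (key g).symm.trans hg
      have h3 := hep
      change Epi (P.π.f 0) at h3
      exact (cancel_epi (P.π.f 0)).1 (hg'.symm.trans Limits.comp_zero.symm)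
    · intro h f hf
      refine ⟨0, ?_⟩
      rw [map_zero]
      symm
      have hf' : P.complex.d 1 0 ≫ f = 0 := hf
      have h5 := P.exact₀.g_desc (k := (f : P.complex.X 0 ⟶ Y)) hf'
      have h6 : (P.exact₀.desc (f : P.complex.X 0 ⟶ Y) hf') = 0 := 
        @Subsingleton.elim (X ⟶ Y) h _ _
      rw [h6, Limits.comp_zero] at h5
      exact h5.symm
  | succ i =>
    rw [HomologicalComplex.exactAt_iff' _ i (i+1) (i+2) (by simp) (by simp), ShortComplex.moduleCat_exact_iff]
    constructor
    · intro h
      refine subsingleton_of_forall_eq 0 fun α => ?_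
      obtain ⟨f, hf, rfl⟩ := P.extMk_surjective α (i+2) rfl
      rw [P.extMk_eq_zero_iff f (i+2) rfl hf i rfl]
      obtain ⟨g, hg⟩ := h f hf
      exact ⟨g, hg⟩
    · intro h f hf
      have := Subsingleton.elim (P.extMk f (i+2) rfl hf) 0
      rw [P.extMk_eq_zero_iff f (i+2) rfl hf i rfl] at this
      obtain ⟨g, hg⟩ := this
      exact ⟨g, hg⟩

theorem extGroup_subsingleton_iff (A : Type) [CommRing A] (i : ℕ) (M N : Type) [AddCommGroup M]
    [Module A M] [AddCommGroup N] [Module A N] :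
    Subsingleton (ExtGroup A i M N) ↔
      Subsingleton (Abelian.Ext (ModuleCat.of A M) (ModuleCat.of A N) i) :=
  oldExt_subsingleton_iff A i _ _


theorem le_of_succ_le_succ_dim (k : ℕ) (y : WithBot ℕ∞) (h : (k : WithBot ℕ∞) + 1 ≤ y + 1) :
    (k : WithBot ℕ∞) ≤ y := by
  induction y with
  | bot => 
    exfalso
    rw [WithBot.bot_add] at h
    have := le_bot_iff.1 h
    have h2 : ((k + 1 : ℕ∞) : WithBot ℕ∞) = ⊥ := by exact_mod_cast this
    exact WithBot.coe_ne_bot h2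
  | coe a =>
    have h2 : ((k + 1 : ℕ∞) : WithBot ℕ∞) ≤ ((a + 1 : ℕ∞) : WithBot ℕ∞) := by exact_mod_cast h
    rw [WithBot.coe_le_coe] at h2
    have h3 : (k : ℕ∞) ≤ a := (ENat.add_le_add_iff_right (by simp)).1 h2
    exact_mod_cast h3

section RegularLocal
open IsLocalRing RingTheory.Sequence
open scoped Pointwise

theorem regLocal_aux (k : ℕ) : ∀ (R : Type) [CommRing R] [IsLocalRing R] [IsNoetherianRing R]
    (a : Fin k → R), maximalIdeal R = Ideal.span (Set.range a) →
    (k : WithBot ℕ∞) ≤ ringKrullDim R →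
    IsDomain R ∧ ∃ rs : List R, rs.length = k ∧ (∀ r ∈ rs, r ∈ maximalIdeal R) ∧
      IsWeaklyRegular R rs := by
  induction k with
  | zero =>
    intro R _ _ _ a ha _
    have h0 : maximalIdeal R = ⊥ := by rw [ha]; simp
    have hf : IsField R := IsLocalRing.isField_iff_maximalIdeal_eq.2 h0
    exact ⟨hf.isDomain, [], rfl, by simp, IsWeaklyRegular.nil R R⟩
  | succ k ih =>
    intro R _ _ _ a ha hdim
    have hmin : ∀ p ∈ minimalPrimes R, ¬ maximalIdeal R ≤ p := by
      intro p hp hle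
      have hpp : p.IsPrime := hp.1.1
      have e : maximalIdeal R = p := le_antisymm hle (le_maximalIdeal hpp.ne_top)
      rw [← e, ← Ideal.height_eq_zero_iff] at hp
      rw [← IsLocalRing.maximalIdeal_height_eq_ringKrullDim, hp] at hdim
      norm_cast at hdim
    have hsq : ¬ maximalIdeal R ≤ maximalIdeal R ^ 2 := by
      intro hle
      have : maximalIdeal R = ⊥ := by
        apply Submodule.eq_bot_of_le_smul_of_le_jacobson_bot (maximalIdeal R) _
          (IsNoetherian.noetherian _)
        · rw [smul_eq_mul, ← pow_two]; exact hle
        · exact maximalIdeal_le_jacobson _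
      obtain ⟨p, hp⟩ := Ideal.nonempty_minimalPrimes (I := (⊥ : Ideal R)) bot_ne_top
      exact hmin p hp (by rw [this]; exact bot_le)
    obtain ⟨x, hx, hx2, hxp⟩ : ∃ x ∈ maximalIdeal R, x ∉ maximalIdeal R ^ 2 ∧
        ∀ p ∈ minimalPrimes R, x ∉ p := by
      by_contra! hcon
      have hfin : (minimalPrimes R).Finite := minimalPrimes.finite_of_isNoetherianRing R
      have := (Ideal.subset_union_prime (s := insert (maximalIdeal R ^ 2) hfin.toFinset)
        (f := fun I : Ideal R => I) (maximalIdeal R ^ 2) (maximalIdeal R ^ 2) (by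
          intro i hi h1 _
          rw [Finset.mem_insert] at hi
          rcases hi with hi | hi
          · exact absurd hi h1
          · exact (hfin.mem_toFinset.1 hi).1.1) (I := maximalIdeal R)).1 (by
          intro y hy
          by_cases hy2 : y ∈ maximalIdeal R ^ 2
          · simp only [Set.mem_iUnion]
            exact ⟨_, by simp, hy2⟩
          · obtain ⟨p, hp, hyp⟩ := hcon y hy hy2
            simp only [Set.mem_iUnion]
            exact ⟨p, by simp [hp], hyp⟩)
      obtain ⟨i, hi, hle⟩ := this
      rw [Finset.mem_insert] at hi
      rcases hi with rfl | hi
      · exact hsq hle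
      · exact hmin i (hfin.mem_toFinset.1 hi) hle
    -- the quotient
    have hxs : Ideal.span {x} ≠ ⊤ := by
      intro h
      rw [Ideal.span_singleton_eq_top] at h
      exact (IsLocalRing.mem_maximalIdeal x).1 hx h
    let q := Ideal.Quotient.mk (Ideal.span {x})
    have : Nontrivial (R ⧸ Ideal.span {x}) := Ideal.Quotient.nontrivial_iff.2 hxs
    have : IsLocalRing (R ⧸ Ideal.span {x}) :=
      IsLocalRing.of_surjective' q Ideal.Quotient.mk_surjective
    have hmap : maximalIdeal (R ⧸ Ideal.span {x}) = (maximalIdeal R).map q := by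
      have h1 : IsLocalHom q := IsLocalHom.of_surjective _ Ideal.Quotient.mk_surjective
      rw [← IsLocalRing.maximalIdeal_comap q, Ideal.map_comap_of_surjective _ Ideal.Quotient.mk_surjective]
    obtain ⟨c, hc⟩ : ∃ c : Fin (k+1) → R, ∑ i, c i * a i = x := by
      rw [ha] at hx
      exact Ideal.mem_span_range_iff_exists_fun.1 hx
    obtain ⟨i, hi⟩ : ∃ i, c i ∉ maximalIdeal R := by
      by_contra! h
      apply hx2
      rw [← hc, pow_two]
      refine Ideal.sum_mem _ fun i _ => Ideal.mul_mem_mul (h i) ?_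
      rw [ha]; exact Ideal.subset_span ⟨i, rfl⟩
    have hu : IsUnit (c i) := by
      by_contra h
      exact hi ((IsLocalRing.mem_maximalIdeal _).2 h)
    have hgen : maximalIdeal (R ⧸ Ideal.span {x}) =
        Ideal.span (Set.range fun j : Fin k => q (a (i.succAbove j))) := by
      rw [hmap, ha, Ideal.map_span]
      apply le_antisymm
      · rw [Ideal.span_le]
        rintro _ ⟨_, ⟨j, rfl⟩, rfl⟩
        rcases Fin.eq_self_or_eq_succAbove i j with rfl | ⟨l, rfl⟩
        · have h1 : q (c j) * q (a j) = - ∑ l, q (c (j.succAbove l)) * q (a (j.succAbove l)) := by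
            rw [eq_neg_iff_add_eq_zero]
            have : q x = 0 := Ideal.Quotient.eq_zero_iff_mem.2 (Ideal.mem_span_singleton_self x)
            rw [← this]
            have h3 := congrArg q hc
            rw [map_sum, Fin.sum_univ_succAbove _ j] at h3
            simpa using h3
          have h2 : q (c j) * q (a j) ∈ Ideal.span (Set.range fun l : Fin k => q (a (j.succAbove l))) := by
            rw [h1]
            refine neg_mem (Ideal.sum_mem _ fun l _ => Ideal.mul_mem_left _ _ (Ideal.subset_span ⟨l, rfl⟩))
          exact (Ideal.unit_mul_mem_iff_mem _ (hu.map q)).1 h2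
        · exact Ideal.subset_span ⟨l, rfl⟩
      · rw [Ideal.span_le]
        rintro _ ⟨j, rfl⟩
        exact Ideal.subset_span ⟨_, ⟨_, rfl⟩, rfl⟩
    have heq : x • (⊤ : Ideal R) = Ideal.span {x} := by
      simp [← Submodule.ideal_span_singleton_smul]
    have hdim' : (k : WithBot ℕ∞) ≤ ringKrullDim (R ⧸ Ideal.span {x}) := by
      have h1 := ringKrullDim_le_ringKrullDim_quotSMulTop_succ hx
      rw [heq] at h1
      have h2 := hdim.trans h1
      push_cast at h2
      exact le_of_succ_le_succ_dim _ _ h2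
    obtain ⟨hdom, rs', hlen, hmem, hreg⟩ := ih (R ⧸ Ideal.span {x}) _ hgen hdim'
    have hprime : (Ideal.span {x}).IsPrime := (Ideal.Quotient.isDomain_iff_prime _).1 hdom
    have hdomR : IsDomain R := by
      obtain ⟨p, hp, hle⟩ := Ideal.exists_minimalPrimes_le (I := (⊥ : Ideal R)) (J := Ideal.span {x}) bot_le
      have hpp : p.IsPrime := hp.1.1
      have : p = ⊥ := by
        apply Submodule.eq_bot_of_le_smul_of_le_jacobson_bot (maximalIdeal R) _
          (IsNoetherian.noetherian _)
        · intro y hy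
          obtain ⟨z, rfl⟩ := Ideal.mem_span_singleton'.1 (hle hy)
          have hz : z ∈ p := (hpp.mem_or_mem hy).resolve_right (hxp p hp)
          rw [mul_comm, smul_eq_mul]
          exact Ideal.mul_mem_mul hx hz
        · exact maximalIdeal_le_jacobson _
      rw [this] at hpp
      exact IsDomain.of_bot_isPrime R
    refine ⟨hdomR, ?_⟩
    obtain ⟨rs, hrs⟩ : ∃ rs : List R, rs.map (algebraMap R (R ⧸ Ideal.span {x})) = rs' :=
      List.map_surjective_iff.2 Ideal.Quotient.mk_surjective rs'
    refine ⟨x :: rs, by rw [← hlen, ← hrs]; simp, ?_, ?_⟩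
    · intro r hr
      rcases List.mem_cons.1 hr with rfl | hr
      · exact hx
      · have := hmem (q r) (by rw [← hrs]; exact List.mem_map_of_mem hr)
        have h1 : IsLocalHom q := IsLocalHom.of_surjective _ Ideal.Quotient.mk_surjective
        rw [← IsLocalRing.maximalIdeal_comap q]
        exact this
    · rw [isWeaklyRegular_cons_iff]
      constructor
      · have hx0 : x ≠ 0 := by
          rintro rfl; exact hx2 (Ideal.zero_mem _)
        exact fun a b hab => mul_left_cancel₀ hx0 hab
      · rw [← hrs, isWeaklyRegular_map_algebraMap_iff] at hreg
        exact (LinearEquiv.isWeaklyRegular_congr (Submodule.quotEquivOfEq _ _ heq) rs).2 hreg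
end RegularLocal


section Depth
open IsLocalRing RingTheory.Sequence

def DGE (R : Type) [CommRing R] [IsLocalRing R] (M : Type) [AddCommGroup M] [Module R M]
    (d : ℕ) : Prop :=
  ∀ i < d, Subsingleton (Abelian.Ext (ModuleCat.of R (R ⧸ maximalIdeal R)) (ModuleCat.of R M) i)

variable {R : Type} [CommRing R] [IsLocalRing R]
  {M₁ M₂ M₃ : Type} [AddCommGroup M₁] [Module R M₁] [AddCommGroup M₂] [Module R M₂]
  [AddCommGroup M₃] [Module R M₃]

theorem shortExact_of (f : M₁ →ₗ[R] M₂) (g : M₂ →ₗ[R] M₃) (hf : Function.Injective f)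
    (hg : Function.Surjective g) (h : Function.Exact f g) :
    (ShortComplex.mk (ModuleCat.ofHom f) (ModuleCat.ofHom g) (by
      ext x; exact h.apply_apply_eq_zero x)).ShortExact where
  exact := (ShortComplex.ShortExact.moduleCat_exact_iff_function_exact _).2 h
  mono_f := (ModuleCat.mono_iff_injective _).2 hf
  epi_g := (ModuleCat.epi_iff_surjective _).2 hg

theorem DGE.middle {d : ℕ} (f : M₁ →ₗ[R] M₂) (g : M₂ →ₗ[R] M₃) (hf : Function.Injective f)
    (hg : Function.Surjective g) (h : Function.Exact f g) (h1 : DGE R M₁ d) (h3 : DGE R M₃ d) :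
    DGE R M₂ d := by
  intro i hi
  have hS := shortExact_of f g hf hg h
  have := h1 i hi
  have := h3 i hi
  refine subsingleton_of_forall_eq 0 fun x => ?_
  obtain ⟨y, hy⟩ := Abelian.Ext.covariant_sequence_exact₂ _ hS x (Subsingleton.elim _ _)
  rw [← hy, (Subsingleton.elim y 0 : y = 0), Abelian.Ext.zero_comp]

theorem DGE.right {d : ℕ} (f : M₁ →ₗ[R] M₂) (g : M₂ →ₗ[R] M₃) (hf : Function.Injective f)
    (hg : Function.Surjective g) (h : Function.Exact f g) (h1 : DGE R M₁ (d + 1))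
    (h2 : DGE R M₂ d) : DGE R M₃ d := by
  intro i hi
  have hS := shortExact_of f g hf hg h
  have := h1 (i+1) (by omega)
  have := h2 i hi
  refine subsingleton_of_forall_eq 0 fun x => ?_
  obtain ⟨y, hy⟩ := Abelian.Ext.covariant_sequence_exact₃ _ hS x (n₁ := i + 1) rfl (Subsingleton.elim _ _)
  rw [← hy, (Subsingleton.elim y 0 : y = 0), Abelian.Ext.zero_comp]

theorem DGE.mono {d e : ℕ} (h : DGE R M₁ e) (hde : d ≤ e) : DGE R M₁ d :=
  fun i hi => h i (by omega)

theorem DGE.of_subsingleton {d : ℕ} [Subsingleton M₁] : DGE R M₁ d := by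
  intro i _
  have : Limits.IsZero (ModuleCat.of R M₁) := ModuleCat.isZero_of_subsingleton _
  refine subsingleton_of_forall_eq 0 fun x => ?_
  have h1 : x = x.comp (Abelian.Ext.mk₀ (𝟙 (ModuleCat.of R M₁))) (add_zero i) := by simp
  rw [h1, this.eq_of_src (𝟙 _) 0]; simp

theorem DGE.of_equiv {d : ℕ} (e : M₁ ≃ₗ[R] M₂) (h : DGE R M₁ d) : DGE R M₂ d := by
  refine DGE.middle (M₁ := M₁) (M₃ := PUnit) e.toLinearMap 0 e.injective
    (fun x => ⟨0, rfl⟩) ?_ h DGE.of_subsingleton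
  intro x
  simp

theorem smul_lt_top [IsNoetherianRing R] [Module.Finite R M₁] [Nontrivial M₁] :
    maximalIdeal R • (⊤ : Submodule R M₁) < ⊤ := by
  rw [lt_top_iff_ne_top]
  intro h
  have h2 := Submodule.eq_bot_of_le_smul_of_le_jacobson_bot (maximalIdeal R) (⊤ : Submodule R M₁)
    Module.Finite.fg_top h.ge (maximalIdeal_le_jacobson _)
  exact top_ne_bot h2

theorem supp_residue : Module.support R (ModuleCat.of R (R ⧸ maximalIdeal R)) =
    PrimeSpectrum.zeroLocus (maximalIdeal R) := by
  change Module.support R (R ⧸ maximalIdeal R) = _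
  rw [Module.support_eq_zeroLocus, Ideal.annihilator_quotient]

theorem DGE.of_isWeaklyRegular [IsNoetherianRing R] [Module.Finite R M₁] (rs : List R)
    (hm : ∀ r ∈ rs, r ∈ maximalIdeal R) (hr : IsWeaklyRegular M₁ rs) : DGE R M₁ rs.length := by
  rcases subsingleton_or_nontrivial M₁ with h | h
  · exact DGE.of_subsingleton
  have hlt := smul_lt_top (R := R) (M₁ := M₁)
  refine ModuleCat.subsingleton_ext_of_exists_isRegular (maximalIdeal R) _ supp_residue.le
    (ModuleCat.of R M₁) hlt rs hm ⟨hr, ?_⟩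
  intro htop
  apply hlt.ne
  rw [eq_top_iff]
  refine htop.le.trans (Submodule.smul_mono_left ?_)
  exact Ideal.span_le.2 hm

theorem DGE.exists_isWeaklyRegular [IsNoetherianRing R] [Module.Finite R M₁] [Nontrivial M₁] (d : ℕ)
    (h : DGE R M₁ d) : ∃ rs : List R, rs.length = d ∧ (∀ r ∈ rs, r ∈ maximalIdeal R) ∧
      IsWeaklyRegular M₁ rs := by
  obtain ⟨rs, h1, h2, h3⟩ := ModuleCat.exists_isRegular_of_exists_subsingleton_ext (maximalIdeal R) d
    (ModuleCat.of R M₁) (smul_lt_top (R := R) (M₁ := M₁)) (ModuleCat.of R (R ⧸ maximalIdeal R)) supp_residue h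
  exact ⟨rs, h1, h2, h3.1⟩

theorem DGE.self (hR : IsRegularLocalRing R) (d : ℕ) (hd : (d : WithBot ℕ∞) ≤ ringKrullDim R) :
    DGE R R d := by
  have h1 := IsRegularLocalRing.spanFinrank_maximalIdeal (R := R)
  have hfg : (maximalIdeal R).FG := IsNoetherian.noetherian _
  obtain ⟨s, hs, hsp⟩ := Submodule.FG.exists_span_finset_card_eq_spanFinrank hfg
  obtain ⟨_, rs, hlen, hm, hreg⟩ := regLocal_aux s.card R (fun i => (s.equivFin.symm i : R)) (by
    rw [← hsp]
    congr 1
    ext x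
    constructor
    · intro hx
      exact ⟨s.equivFin ⟨x, hx⟩, by simp⟩
    · rintro ⟨i, rfl⟩
      exact (s.equivFin.symm i).2) (by rw [hs]; exact h1.le)
  refine (DGE.of_isWeaklyRegular rs hm hreg).mono ?_
  rw [hlen, hs]
  rw [← h1] at hd
  exact_mod_cast hd
end Depth


section Mono
open MvPolynomial
variable {K : Type} [Field K] {n : ℕ}

noncomputable def monoIdeal (K : Type) [Field K] {n : ℕ} (T : (Fin n →₀ ℕ) → Prop) : Ideal (MvPolynomial (Fin n) K) :=
  Ideal.span ((fun d => monomial d (1 : K)) '' {d | T d})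

def UpC {n : ℕ} (T : (Fin n →₀ ℕ) → Prop) : Prop := ∀ d e, d ≤ e → T d → T e

theorem mem_monoIdeal {T : (Fin n →₀ ℕ) → Prop} (hT : UpC T) {p : MvPolynomial (Fin n) K} :
    p ∈ monoIdeal K T ↔ ∀ d ∈ p.support, T d := by
  rw [monoIdeal, mem_ideal_span_monomial_image]
  exact forall₂_congr fun d _ => ⟨fun ⟨e, h1, h2⟩ => hT e d h2 h1, fun h => ⟨d, h, le_rfl⟩⟩

theorem upC_weight (F : Finset (Fin n)) (m : ℕ) :
    UpC fun d : Fin n →₀ ℕ => m ≤ ∑ i ∈ F, d i :=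
  fun _ _ h h2 => h2.trans (Finset.sum_le_sum fun i _ => h i)

theorem PF_pow_eq (F : Finset (Fin n)) (m : ℕ) :
    PF K F ^ m = monoIdeal K fun d => m ≤ ∑ i ∈ F, d i := by
  apply le_antisymm
  · induction m with
    | zero =>
      intro p _
      rw [mem_monoIdeal (upC_weight F 0)]
      simp
    | succ m ih =>
      rw [pow_succ, Ideal.mul_le]
      intro p hp q hq
      have hp' := (mem_monoIdeal (upC_weight F m)).1 (ih hp)
      have hq' : ∀ d ∈ q.support, 1 ≤ ∑ i ∈ F, d i := by
        rw [← mem_monoIdeal (upC_weight F 1)]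
        revert q
        change PF K F ≤ _
        rw [PF, Ideal.span_le]
        rintro _ ⟨i, hi, rfl⟩
        apply Ideal.subset_span
        refine ⟨Finsupp.single i 1, ?_, rfl⟩
        change 1 ≤ ∑ j ∈ F, (Finsupp.single i 1 : Fin n →₀ ℕ) j
        calc 1 = (Finsupp.single i 1 : Fin n →₀ ℕ) i := by simp
          _ ≤ _ := Finset.single_le_sum (f := fun j => (Finsupp.single i 1 : Fin n →₀ ℕ) j) (fun _ _ => Nat.zero_le _) hi
      rw [mem_monoIdeal (upC_weight F _)]
      intro d hd
      classical
      obtain ⟨a, ha, b, hb, rfl⟩ := Finset.mem_add.1 (support_mul p q hd)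
      have := hp' a ha
      have := hq' b hb
      simp only [Finsupp.add_apply, Finset.sum_add_distrib]
      omega
  · rw [monoIdeal, Ideal.span_le]
    rintro _ ⟨d, hd, rfl⟩
    change m ≤ ∑ i ∈ F, d i at hd
    refine Ideal.pow_le_pow_right hd ?_
    have h1 : (∏ i ∈ F, (X i : MvPolynomial (Fin n) K) ^ d i) ∈ PF K F ^ (∑ i ∈ F, d i) := by
      rw [← Finset.prod_pow_eq_pow_sum]
      refine Ideal.prod_mem_prod fun i hi => Ideal.pow_mem_pow ?_ _
      exact Ideal.subset_span ⟨i, hi, rfl⟩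
    have h2 : (monomial d (1:K)) = (∏ i ∈ F, (X i : MvPolynomial (Fin n) K) ^ d i) * ∏ i ∈ Fᶜ, X i ^ d i := by
      rw [Finset.prod_mul_prod_compl, monomial_eq]
      simp [Finsupp.prod_fintype]
    change monomial d (1:K) ∈ _
    rw [h2]
    exact Ideal.mul_mem_right _ _ h1

theorem mem_PF_pow {F : Finset (Fin n)} {m : ℕ} {p : MvPolynomial (Fin n) K} :
    p ∈ PF K F ^ m ↔ ∀ d ∈ p.support, m ≤ ∑ i ∈ F, d i := by
  rw [PF_pow_eq, mem_monoIdeal (upC_weight F m)]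

theorem coverSymbPow_eq (Δ : SimComplex n) (m : ℕ) :
    coverSymbPow K Δ m = monoIdeal K fun d => ∀ F, Δ.IsFacet F → m ≤ ∑ i ∈ F, d i := by
  ext p
  have hU : UpC fun d : Fin n →₀ ℕ => ∀ F, Δ.IsFacet F → m ≤ ∑ i ∈ F, d i :=
    fun _ _ h h2 F hF => upC_weight F m _ _ h (h2 F hF)
  rw [mem_monoIdeal hU]
  simp only [coverSymbPow, Submodule.mem_iInf, mem_PF_pow]
  exact ⟨fun h d hd F hF => h F hF d hd, fun h F hF d hd => h d hd F hF⟩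

theorem X_mul_mem_monoIdeal {T : (Fin n →₀ ℕ) → Prop} (hT : UpC T) (v : Fin n)
    (p : MvPolynomial (Fin n) K) :
    p ∈ monoIdeal K (fun d => T (d + Finsupp.single v 1)) ↔ X v * p ∈ monoIdeal K T := by
  rw [mem_monoIdeal hT, mem_monoIdeal (fun d e h h2 => hT _ _ (by gcongr) h2)]
  simp only [support_X_mul, Finset.mem_map]
  constructor
  · rintro h _ ⟨d, hd, rfl⟩
    rw [addLeftEmbedding_apply, add_comm]; exact h d hd
  · intro h d hd
    rw [add_comm]
    exact h _ ⟨d, hd, rfl⟩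

theorem monoIdeal_or {T : (Fin n →₀ ℕ) → Prop} (v : Fin n) :
    monoIdeal K (fun d => T d ∨ 1 ≤ d v) = monoIdeal K T ⊔ Ideal.span {X v} := by
  apply le_antisymm
  · rw [monoIdeal, Ideal.span_le]
    rintro _ ⟨d, hd | hd, rfl⟩
    · exact Ideal.mem_sup_left (Ideal.subset_span ⟨d, hd, rfl⟩)
    · apply Ideal.mem_sup_right
      rw [Ideal.mem_span_singleton]
      refine ⟨monomial (d - Finsupp.single v 1) 1, ?_⟩
      change monomial d 1 = _
      rw [X, monomial_mul, mul_one, add_tsub_cancel_of_le (by simpa using hd)]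
  · refine sup_le (Ideal.span_mono (Set.image_mono fun d hd => Or.inl hd)) ?_
    rw [Ideal.span_singleton_le_iff_mem]
    exact Ideal.subset_span ⟨Finsupp.single v 1, Or.inr (by simp), rfl⟩
end Mono


section LocDepth
variable {S : Type} [CommRing S] (Q : Ideal S) [Q.IsPrime]

def DL (I : Ideal S) (d : ℕ) : Prop :=
  DGE (Localization.AtPrime Q) (LocalizedModule Q.primeCompl (S ⧸ I)) d

variable {Q}

noncomputable abbrev locMap {M N : Type} [AddCommGroup M] [Module S M] [AddCommGroup N] [Module S N]
    (f : M →ₗ[S] N) : LocalizedModule Q.primeCompl M →ₗ[Localization.AtPrime Q]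
      LocalizedModule Q.primeCompl N :=
  LinearMap.extendScalarsOfIsLocalization Q.primeCompl (Localization.AtPrime Q)
    (IsLocalizedModule.map Q.primeCompl (LocalizedModule.mkLinearMap Q.primeCompl M)
      (LocalizedModule.mkLinearMap Q.primeCompl N) f)

section ses
variable (x : S) (A I C : Ideal S) (h1 : ∀ p, p ∈ A ↔ x * p ∈ I) (h2 : C = I ⊔ Ideal.span {x})

noncomputable def sesF (h1 : ∀ p, p ∈ A ↔ x * p ∈ I) : (S ⧸ A) →ₗ[S] (S ⧸ I) :=
  Submodule.mapQ A I (LinearMap.lsmul S S x) (fun p hp => (h1 p).1 hp)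

noncomputable def sesG (h2 : C = I ⊔ Ideal.span {x}) : (S ⧸ I) →ₗ[S] (S ⧸ C) :=
  Submodule.mapQ I C LinearMap.id (by rw [h2]; exact le_sup_left)

theorem sesF_inj : Function.Injective (sesF x A I h1) := by
  rw [← LinearMap.ker_eq_bot, LinearMap.ker_eq_bot']
  intro p
  obtain ⟨p, rfl⟩ := Submodule.Quotient.mk_surjective _ p
  intro h
  rw [Submodule.Quotient.mk_eq_zero]
  exact (h1 p).2 ((Submodule.Quotient.mk_eq_zero I).1 h)

theorem sesG_surj : Function.Surjective (sesG x I C h2) := by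
  intro p
  obtain ⟨p, rfl⟩ := Submodule.Quotient.mk_surjective _ p
  exact ⟨Submodule.Quotient.mk p, rfl⟩

theorem ses_exact : Function.Exact (sesF x A I h1) (sesG x I C h2) := by
  intro p
  obtain ⟨p, rfl⟩ := Submodule.Quotient.mk_surjective _ p
  constructor
  · intro h
    have h3 : p ∈ C := (Submodule.Quotient.mk_eq_zero C).1 h
    rw [h2, Submodule.mem_sup] at h3
    obtain ⟨a, ha, b, hb, rfl⟩ := h3
    obtain ⟨c, rfl⟩ := Ideal.mem_span_singleton.1 hb
    refine ⟨Submodule.Quotient.mk c, ?_⟩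
    change (Submodule.Quotient.mk (x * c) : S ⧸ I) = _
    rw [Submodule.Quotient.eq]
    simpa using ha
  · rintro ⟨q, hq⟩
    obtain ⟨q, rfl⟩ := Submodule.Quotient.mk_surjective _ q
    have hq' : (Submodule.Quotient.mk (x * q) : S ⧸ I) = Submodule.Quotient.mk p := hq
    rw [← hq']
    change (Submodule.Quotient.mk (x * q) : S ⧸ C) = 0
    rw [Submodule.Quotient.mk_eq_zero, h2]
    exact Ideal.mem_sup_right (Ideal.mem_span_singleton.2 ⟨q, rfl⟩)

theorem DL.middle (x : S) (A I C : Ideal S) (h1 : ∀ p, p ∈ A ↔ x * p ∈ I)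
    (h2 : C = I ⊔ Ideal.span {x}) {d : ℕ} (hA : DL Q A d) (hC : DL Q C d) : DL Q I d :=
  DGE.middle (locMap (sesF x A I h1)) (locMap (sesG x I C h2))
    (IsLocalizedModule.map_injective _ _ _ _ (sesF_inj x A I h1))
    (IsLocalizedModule.map_surjective _ _ _ _ (sesG_surj x I C h2))
    (IsLocalizedModule.map_exact _ _ _ _ _ _ (ses_exact x A I C h1 h2)) hA hC

theorem DL.right (x : S) (A I C : Ideal S) (h1 : ∀ p, p ∈ A ↔ x * p ∈ I)
    (h2 : C = I ⊔ Ideal.span {x}) {d : ℕ} (hA : DL Q A (d + 1)) (hI : DL Q I d) : DL Q C d :=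
  DGE.right (locMap (sesF x A I h1)) (locMap (sesG x I C h2))
    (IsLocalizedModule.map_injective _ _ _ _ (sesF_inj x A I h1))
    (IsLocalizedModule.map_surjective _ _ _ _ (sesG_surj x I C h2))
    (IsLocalizedModule.map_exact _ _ _ _ _ _ (ses_exact x A I C h1 h2)) hA hI
end ses

theorem DL.of_not_le {I : Ideal S} {d : ℕ} (h : ¬ I ≤ Q) : DL Q I d := by
  obtain ⟨x, hx, hxQ⟩ := SetLike.not_le_iff_exists.1 h
  have : Subsingleton (LocalizedModule Q.primeCompl (S ⧸ I)) := by
    rw [LocalizedModule.subsingleton_iff]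
    intro m
    obtain ⟨p, rfl⟩ := Submodule.Quotient.mk_surjective _ m
    refine ⟨x, hxQ, ?_⟩
    rw [← Submodule.Quotient.mk_smul, Submodule.Quotient.mk_eq_zero]
    exact Ideal.mul_mem_right _ _ hx
  exact DGE.of_subsingleton

theorem DL.bot {d : ℕ} (hR : IsRegularLocalRing (Localization.AtPrime Q)) (hd : (d : ℕ∞) ≤ Q.height) :
    DL Q (⊥ : Ideal S) d := by
  have h1 : DGE (Localization.AtPrime Q) (Localization.AtPrime Q) d := by
    apply DGE.self hR
    rw [IsLocalization.AtPrime.ringKrullDim_eq_height Q]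
    exact_mod_cast hd
  let e : LocalizedModule Q.primeCompl S ≃ₗ[Localization.AtPrime Q] LocalizedModule Q.primeCompl (S ⧸ (⊥ : Ideal S)) :=
    IsLocalizedModule.mapEquiv Q.primeCompl (LocalizedModule.mkLinearMap Q.primeCompl S)
      (LocalizedModule.mkLinearMap Q.primeCompl (S ⧸ (⊥ : Ideal S))) (Localization.AtPrime Q)
      ((Submodule.quotEquivOfEqBot (⊥ : Ideal S) rfl).symm)
  exact DGE.of_equiv e h1
end LocDepth


section Rec
open MvPolynomial
variable {K : Type} [Field K] {n : ℕ}

def RevEx {n : ℕ} (B : Set (Finset (Fin n))) : Prop :=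
  ∀ B₁ ∈ B, ∀ B₂ ∈ B, ∀ v ∈ B₂, v ∉ B₁ → ∃ u ∈ B₁, u ∉ B₂ ∧ insert v (B₁.erase u) ∈ B

def wT {n : ℕ} (B : Set (Finset (Fin n))) (m : ℕ) (c : Fin n → ℕ) (d : Fin n →₀ ℕ) : Prop :=
  ∀ A ∈ B, m ≤ ∑ i ∈ A, (d i + c i)

theorem upC_wT (B : Set (Finset (Fin n))) (m : ℕ) (c : Fin n → ℕ) : UpC (wT B m c) :=
  fun _ _ h h2 A hA => (h2 A hA).trans (Finset.sum_le_sum fun i _ => Nat.add_le_add_right (h i) _)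

def contr {n : ℕ} (B : Set (Finset (Fin n))) (v : Fin n) : Set (Finset (Fin n)) :=
  {A | v ∉ A ∧ insert v A ∈ B}

theorem RevEx.contr {B : Set (Finset (Fin n))} (h : RevEx B) (v : Fin n) : RevEx (contr B v) := by
  rintro A₁ ⟨h1, h1'⟩ A₂ ⟨h2, h2'⟩ w hw hw'
  have hwv : w ≠ v := by rintro rfl; exact h2 hw
  obtain ⟨u, hu, hu2, hu3⟩ := h _ h1' _ h2' w (Finset.mem_insert_of_mem hw) (by
    simp [hwv, hw'])
  have huv : u ≠ v := by rintro rfl; exact hu2 (Finset.mem_insert_self _ _)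
  refine ⟨u, (Finset.mem_insert.1 hu).resolve_left huv, fun h => hu2 (Finset.mem_insert_of_mem h), ?_, ?_⟩
  · simp [hwv.symm, h1]
  · rw [Finset.insert_comm]
    convert hu3 using 2
    rw [Finset.erase_insert_of_ne huv.symm]

theorem monoIdeal_true {T : (Fin n →₀ ℕ) → Prop} (h : ∀ d, T d) : monoIdeal K T = ⊤ := by
  rw [Ideal.eq_top_iff_one]
  exact Ideal.subset_span ⟨0, h 0, rfl⟩

theorem monoIdeal_congr {T T' : (Fin n →₀ ℕ) → Prop} (h : ∀ d, T d ↔ T' d) :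
    monoIdeal K T = monoIdeal K T' := by
  rw [show T = T' from funext fun d => propext (h d)]

theorem DL_main (Q : Ideal (MvPolynomial (Fin n) K)) [Q.IsPrime] (r : ℕ) :
    ∀ (N : ℕ) (B : Set (Finset (Fin n))) (_ : RevEx B) (_ : ∀ A ∈ B, A.card = r) (m : ℕ)
      (c : Fin n → ℕ) (d : ℕ), ∑ i, (m - c i) ≤ N → ((d + r : ℕ) : ℕ∞) ≤ Q.height →
      DL Q (monoIdeal K (wT B m c)) d := by
  induction r with
  | zero =>
    intro N B hB hr m c d _ hd
    by_cases hT : wT B m c 0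
    · rw [monoIdeal_true fun d => upC_wT B m c _ _ (zero_le) hT]
      exact DL.of_not_le (fun h => ‹Q.IsPrime›.ne_top (top_le_iff.1 h))
    · have : monoIdeal K (wT B m c) = ⊥ := by
        have : {d | wT B m c d} = ∅ := by
          ext d
          simp only [Set.mem_ofPred_eq, Set.mem_empty_iff_false, iff_false]
          intro hd
          apply hT
          intro A hA
          have := hd A hA
          rw [Finset.card_eq_zero.1 (hr A hA)] at this ⊢
          simpa using this
        rw [monoIdeal, this]; simp
      rw [this]
      exact DL.bot inferInstance (by simpa using hd)
  | succ r ih =>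
    intro N
    induction N with
    | zero =>
      intro B hB hr m c d hN hd
      rw [monoIdeal_true]
      · exact DL.of_not_le (fun h => ‹Q.IsPrime›.ne_top (top_le_iff.1 h))
      · intro d A hA
        obtain ⟨i, hi⟩ : A.Nonempty := by
          rw [← Finset.card_pos, hr A hA]; omega
        have h1 : m - c i ≤ ∑ i, (m - c i) := Finset.single_le_sum (f := fun i => m - c i) (fun _ _ => Nat.zero_le _) (Finset.mem_univ i)
        have h2 : d i + c i ≤ ∑ i ∈ A, (d i + c i) := Finset.single_le_sum (f := fun i => d i + c i) (fun _ _ => Nat.zero_le _) hi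
        omega
    | succ N ihN =>
      intro B hB hr m c d hN hd
      classical
      let L : Finset (Fin n) := Finset.univ.filter fun v => ∃ A ∈ B, v ∈ A
      have hL : ∀ v, v ∈ L ↔ ∃ A ∈ B, v ∈ A := fun v => by simp [L]
      by_cases hall : ∀ v ∈ L, m ≤ c v
      · rw [monoIdeal_true]
        · exact DL.of_not_le (fun h => ‹Q.IsPrime›.ne_top (top_le_iff.1 h))
        · intro d A hA
          obtain ⟨i, hi⟩ : A.Nonempty := by
            rw [← Finset.card_pos, hr A hA]; omega
          have h1 := hall i ((hL i).2 ⟨A, hA, hi⟩)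
          have h2 : d i + c i ≤ ∑ i ∈ A, (d i + c i) := Finset.single_le_sum (f := fun i => d i + c i) (fun _ _ => Nat.zero_le _) hi
          omega
      · push Not at hall
        obtain ⟨w, hw, hwm⟩ := hall
        obtain ⟨v, hv, hvmin⟩ := Finset.exists_min_image L c ⟨w, hw⟩
        have hvm : c v < m := (hvmin w hw).trans_lt hwm
        have hU := upC_wT B m c
        have hU0 := upC_wT (contr B v) (m - c v) c
        -- A
        have hA : DL Q (monoIdeal K fun d => wT B m c (d + Finsupp.single v 1)) d := by
          rw [monoIdeal_congr (T' := wT B m (fun i => c i + (Finsupp.single v 1 : Fin n →₀ ℕ) i))]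
          · apply ihN B hB hr _ _ _ _ hd
            have : ∑ i, (m - (c i + (Finsupp.single v 1 : Fin n →₀ ℕ) i)) < ∑ i, (m - c i) := by
              apply Finset.sum_lt_sum
              · intro i _; omega
              · refine ⟨v, Finset.mem_univ _, ?_⟩
                simp; omega
            omega
          · intro d
            simp only [wT, Finsupp.add_apply]
            refine forall₂_congr fun A hA => ?_
            rw [Finset.sum_congr rfl fun i _ => ?_]
            omega
        refine DL.middle (X v) _ _ _ (X_mul_mem_monoIdeal hU v) (monoIdeal_or v) hA ?_
        by_cases hvQ : X v ∈ Q
        swap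
        · apply DL.of_not_le
          intro h
          rw [monoIdeal_or] at h
          exact hvQ (h (Ideal.mem_sup_right (Ideal.mem_span_singleton_self _)))
        have key : ∀ e : Fin n →₀ ℕ, (wT B m c e ∨ 1 ≤ e v) ↔ (wT (contr B v) (m - c v) c e ∨ 1 ≤ e v) := by
          intro e
          by_cases he : 1 ≤ e v
          · simp [he]
          have he0 : e v = 0 := by omega
          simp only [he, or_false]
          constructor
          · rintro h A ⟨hvA, hA⟩
            have := h _ hA
            rw [Finset.sum_insert hvA, he0] at this
            omega
          · intro h A hA
            have h3 : ∀ A ∈ B, v ∈ A → m ≤ c v + ∑ i ∈ A.erase v, (e i + c i) := by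
              intro A hA hvA
              have := h (A.erase v) ⟨by simp, by rwa [Finset.insert_erase hvA]⟩
              omega
            by_cases hvA : v ∈ A
            · rw [← Finset.add_sum_erase _ _ hvA, he0]
              have := h3 A hA hvA
              omega
            · obtain ⟨A₂, hA₂, hvA₂⟩ := (hL v).1 hv
              obtain ⟨u, hu, hu2, hu3⟩ := hB A hA A₂ hA₂ v hvA₂ hvA
              have h4 := h3 _ hu3 (Finset.mem_insert_self _ _)
              rw [Finset.erase_insert (by simp [hvA])] at h4
              rw [← Finset.add_sum_erase _ _ hu]
              have := hvmin u ((hL u).2 ⟨A, hA, hu⟩)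
              omega
        rw [monoIdeal_congr key]
        have hr' : ∀ A ∈ contr B v, A.card = r := by
          rintro A ⟨h1, h2⟩
          have := hr _ h2
          rw [Finset.card_insert_of_notMem h1] at this
          omega
        have hI : DL Q (monoIdeal K (wT (contr B v) (m - c v) c)) (d + 1) := 
          ih _ _ (hB.contr v) hr' _ _ _ le_rfl (by rwa [show d + 1 + r = d + (r + 1) by ring])
        refine DL.right (X v) (monoIdeal K (wT (contr B v) (m - c v) c)) _ _ ?_ (monoIdeal_or v) hI 
          (DGE.mono hI (Nat.le_succ d))
        intro p
        rw [← X_mul_mem_monoIdeal hU0, monoIdeal_congr]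
        intro e
        refine forall₂_congr fun A hA => ?_
        rw [Finset.sum_congr rfl fun i hi => ?_]
        have : i ≠ v := by rintro rfl; exact hA.1 hi
        simp [this.symm]
end Rec


section Transfer
variable {S : Type} [CommRing S] [IsNoetherianRing S]

theorem DL.transfer (I : Ideal S) (P : Ideal (S ⧸ I)) [P.IsPrime] (d : ℕ)
    (h : DL (P.comap (Ideal.Quotient.mk I)) I d) :
    DGE (Localization.AtPrime P) (Localization.AtPrime P) d := by
  set Q := P.comap (Ideal.Quotient.mk I) with hQ
  let R := Localization.AtPrime Q
  let B := Localization.AtPrime P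
  let φ : R →+* B := Localization.localRingHom Q P (Ideal.Quotient.mk I) rfl
  let : Algebra R B := φ.toAlgebra
  have hsurj : Function.Surjective φ :=
    RingHom.surjective_localRingHom_of_surjective (Ideal.Quotient.mk I) Ideal.Quotient.mk_surjective P
  have : IsScalarTower S R B := by
    apply IsScalarTower.of_algebraMap_eq
    intro x
    change _ = φ (algebraMap S R x)
    rw [Localization.localRingHom_to_map]
    rfl
  have hM : Algebra.algebraMapSubmonoid (S ⧸ I) Q.primeCompl = P.primeCompl := by
    ext x
    obtain ⟨x, rfl⟩ := Ideal.Quotient.mk_surjective x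
    constructor
    · rintro ⟨y, hy, hyx⟩
      change algebraMap S (S ⧸ I) y = _ at hyx
      rw [← hyx]
      exact hy
    · intro hx
      exact ⟨x, hx, rfl⟩
  have : IsLocalization (Algebra.algebraMapSubmonoid (S ⧸ I) Q.primeCompl) B := by
    rw [hM]; infer_instance
  have : IsLocalizedModule Q.primeCompl ((IsScalarTower.toAlgHom S (S ⧸ I) B).toLinearMap) :=
    isLocalizedModule_iff_isLocalization.2 inferInstance
  let e : LocalizedModule Q.primeCompl (S ⧸ I) ≃ₗ[R] B :=
    LinearEquiv.extendScalarsOfIsLocalization Q.primeCompl R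
      (IsLocalizedModule.iso Q.primeCompl ((IsScalarTower.toAlgHom S (S ⧸ I) B).toLinearMap))
  have h2 : DGE R B d := DGE.of_equiv e h
  have : Module.Finite R B := Module.Finite.of_surjective (Algebra.linearMap R B) hsurj
  obtain ⟨rs, hl, hm, hr⟩ := DGE.exists_isWeaklyRegular d h2
  rw [← hl, ← List.length_map (f := algebraMap R B)]
  apply DGE.of_isWeaklyRegular
  · intro r hr
    obtain ⟨s, hs, rfl⟩ := List.mem_map.1 hr
    have hl : IsLocalHom φ := Localization.isLocalHom_localRingHom _ _ _ _
    have := hm s hs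
    rw [IsLocalRing.mem_maximalIdeal, mem_nonunits_iff] at this ⊢
    exact fun hu => this (isUnit_of_map_unit φ s hu)
  · exact (RingTheory.Sequence.isWeaklyRegular_map_algebraMap_iff B B rs).2 hr
end Transfer


section Primary
open MvPolynomial
variable {K : Type} [Field K] {n : ℕ}

noncomputable def grad (K : Type) [Field K] {n : ℕ} (F : Finset (Fin n)) :
    MvPolynomial (Fin n) K →ₐ[K] Polynomial (MvPolynomial (Fin n) K) :=
  aeval fun i => if i ∈ F then Polynomial.X * Polynomial.C (X i) else Polynomial.C (X i)

theorem grad_monomial (F : Finset (Fin n)) (d : Fin n →₀ ℕ) (c : K) :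
    grad K F (monomial d c) = Polynomial.X ^ (∑ i ∈ F, d i) * Polynomial.C (monomial d c) := by
  have h : ∀ i, (if i ∈ F then Polynomial.X * Polynomial.C (X i) else Polynomial.C (X i) :
      Polynomial (MvPolynomial (Fin n) K)) = Polynomial.X ^ (if i ∈ F then 1 else 0) * Polynomial.C (X i) := by
    intro i; split_ifs <;> simp
  unfold grad
  rw [aeval_monomial, Finsupp.prod_fintype _ _ (by simp)]
  simp_rw [h, mul_pow, Finset.prod_mul_distrib, ← pow_mul, Finset.prod_pow_eq_pow_sum]
  rw [monomial_eq, Finsupp.prod_fintype _ _ (by simp)]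
  simp only [ite_mul, one_mul, zero_mul, Finset.sum_ite_mem, Finset.univ_inter, map_mul, map_prod, map_pow]
  rw [mul_left_comm]
  rfl

theorem coeff_grad (F : Finset (Fin n)) (p : MvPolynomial (Fin n) K) (k : ℕ) (e : Fin n →₀ ℕ) :
    coeff e ((grad K F p).coeff k) = if ∑ i ∈ F, e i = k then coeff e p else 0 := by
  induction p using MvPolynomial.induction_on' with
  | monomial d c =>
    rw [grad_monomial, Polynomial.coeff_X_pow_mul', Polynomial.coeff_C]
    by_cases hde : d = e
    · subst hde
      split_ifs with h1 h2 h3 h3 h4 <;> simp <;> omega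
    · split_ifs <;> simp [coeff_monomial, hde]
  | add p q hp hq => 
    rw [map_add, Polynomial.coeff_add, coeff_add, hp, hq]; split_ifs <;> simp

theorem mem_PF_pow_iff_dvd (F : Finset (Fin n)) (m : ℕ) (p : MvPolynomial (Fin n) K) :
    p ∈ PF K F ^ m ↔ (Polynomial.X ^ m) ∣ grad K F p := by
  rw [mem_PF_pow, Polynomial.X_pow_dvd_iff]
  constructor
  · intro h k hk
    ext e
    rw [coeff_grad]
    split_ifs with h1
    · by_contra h2
      have := h e (mem_support_iff.2 h2)
      omega
    · simp
  · intro h e he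
    by_contra h2
    have := congrArg (coeff e) (h (∑ i ∈ F, e i) (by omega))
    rw [coeff_grad, if_pos rfl] at this
    exact mem_support_iff.1 he this

theorem PF_primary {F : Finset (Fin n)} {m : ℕ} {p q : MvPolynomial (Fin n) K}
    (h : q * p ∈ PF K F ^ m) (hq : q ∉ PF K F) : p ∈ PF K F ^ m := by
  rw [mem_PF_pow_iff_dvd, map_mul] at h
  rw [mem_PF_pow_iff_dvd]
  refine Prime.pow_dvd_of_dvd_mul_left Polynomial.prime_X m ?_ h
  intro h2
  apply hq
  rw [← pow_one (PF K F), mem_PF_pow_iff_dvd, pow_one]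
  exact h2

theorem X_mem_PF {F : Finset (Fin n)} {i : Fin n} : X i ∈ PF K F ↔ i ∈ F := by
  rw [← pow_one (PF K F), mem_PF_pow]
  rw [support_X]
  simp only [Finset.mem_singleton, forall_eq]
  simp [Finsupp.single_apply, Nat.one_le_iff_ne_zero]

instance PF_prime (F : Finset (Fin n)) : (PF K F).IsPrime := by
  refine ⟨?_, ?_⟩
  · rw [Ne, Ideal.eq_top_iff_one, ← pow_one (PF K F), mem_PF_pow]
    intro h
    have := h 0 (by simp)
    simp at this
  · intro a b hab
    by_cases ha : a ∈ PF K F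
    · exact Or.inl ha
    · right
      have := PF_primary (m := 1) (by simpa using hab) ha
      simpa using this

theorem PF_mono {F G : Finset (Fin n)} (h : F ⊆ G) : PF K F ≤ PF K G :=
  Ideal.span_mono (Set.image_mono (by exact_mod_cast h))

theorem card_le_height_PF (F : Finset (Fin n)) : (F.card : ℕ∞) ≤ (PF K F).height := by
  induction F using Finset.induction_on with
  | empty => simp
  | insert a F ha ih =>
    rw [Finset.card_insert_of_notMem ha]
    have hlt : PF K F < PF K (insert a F) := by
      refine lt_of_le_of_ne (PF_mono (Finset.subset_insert _ _)) ?_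
      intro h
      apply ha
      rw [← X_mem_PF (K := K), h, X_mem_PF]
      exact Finset.mem_insert_self _ _
    refine le_trans ?_ (Ideal.height_add_one_le_of_lt_of_isPrime hlt)
    push_cast
    gcongr

/-- any prime containing the symbolic power contains a facet prime -/
theorem exists_PF_le {Δ : SimComplex n} {m : ℕ} {Q : Ideal (MvPolynomial (Fin n) K)} [hQ : Q.IsPrime]
    (h : coverSymbPow K Δ m ≤ Q) : ∃ F, Δ.IsFacet F ∧ PF K F ≤ Q := by
  classical
  have h2 : (Finset.univ.filter (fun F => Δ.IsFacet F)).inf (fun F => PF K F ^ m) ≤ Q := by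
    refine le_trans ?_ h
    unfold coverSymbPow
    refine le_iInf₂ fun F hF => Finset.inf_le (by simpa using hF)
  rw [Ideal.IsPrime.inf_le' hQ] at h2
  obtain ⟨F, hF, hle⟩ := h2
  refine ⟨F, by simpa using hF, Ideal.IsPrime.le_of_pow_le hle⟩

theorem height_comap_quot {S : Type} [CommRing S] (I : Ideal S) (r : ℕ)
    (h : ∀ Q : Ideal S, Q.IsPrime → I ≤ Q → (r : ℕ∞) ≤ Q.height) (i : ℕ) :
    ∀ (P : Ideal (S ⧸ I)) [P.IsPrime], (i : ℕ∞) ≤ P.height →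
      ((i + r : ℕ) : ℕ∞) ≤ (P.comap (Ideal.Quotient.mk I)).height := by
  induction i with
  | zero =>
    intro P hP _
    rw [zero_add]
    refine h _ inferInstance ?_
    intro x hx
    rw [Ideal.mem_comap, Ideal.Quotient.eq_zero_iff_mem.2 hx]
    exact zero_mem _
  | succ i ih =>
    intro P hP hi
    obtain ⟨P', hP', hlt, hi'⟩ : ∃ P' : Ideal (S ⧸ I), P'.IsPrime ∧ P' < P ∧ (i : ℕ∞) ≤ P'.height := by
      rw [PrimeSpectrum.height_eq_orderHeight ⟨P, hP⟩] at hi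
      obtain ⟨p, hp, hl⟩ := Order.exists_series_of_le_height _ hi
      refine ⟨(p ⟨i, by omega⟩).asIdeal, (p ⟨i, by omega⟩).2, ?_, ?_⟩
      · have : p ⟨i, by omega⟩ < p.last := p.strictMono (by rw [Fin.lt_def]; simp [hl])
        rw [hp] at this
        exact this
      · rw [PrimeSpectrum.height_eq_orderHeight]
        exact Order.index_le_height p ⟨i, by omega⟩
    have h1 := ih P' hi'
    have h2 : P'.comap (Ideal.Quotient.mk I) < P.comap (Ideal.Quotient.mk I) := by
      refine lt_of_le_of_ne (Ideal.comap_mono hlt.le) ?_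
      intro h
      exact hlt.ne (Ideal.comap_injective_of_surjective _ Ideal.Quotient.mk_surjective h)
    refine le_trans ?_ (Ideal.height_add_one_le_of_lt_of_isPrime h2)
    rw [show i + 1 + r = (i + r) + 1 by ring]
    push_cast at h1 ⊢
    gcongr

theorem CM_of_revEx (Δ : SimComplex n) (r : ℕ) (hr : ∀ F, Δ.IsFacet F → F.card = r)
    (hB : RevEx {F | Δ.IsFacet F}) (m : ℕ) : IsCohenMacaulayIdeal (coverSymbPow K Δ m) := by
  intro P hP i hi
  rw [extGroup_subsingleton_iff]
  rw [IsLocalization.AtPrime.ringKrullDim_eq_height P] at hi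
  have hi' : ((i + 1 : ℕ) : ℕ∞) ≤ P.height := by
    have : (i : ℕ∞) < P.height := by exact_mod_cast hi
    push_cast
    exact Order.add_one_le_of_lt this
  have hh := height_comap_quot (coverSymbPow K Δ m) r (by
    intro Q hQ hle
    obtain ⟨F, hF, hFQ⟩ := exists_PF_le hle
    rw [← hr F hF]
    exact (card_le_height_PF F).trans (Ideal.height_mono hFQ)) (i+1) P hi'
  have := DL_main (K := K) (P.comap (Ideal.Quotient.mk _)) r _ {F | Δ.IsFacet F} hB hr m 0 (i+1) le_rfl hh
  have h3 : DL (P.comap (Ideal.Quotient.mk (coverSymbPow K Δ m))) (coverSymbPow K Δ m) (i+1) := by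
    convert this using 1
    rw [coverSymbPow_eq]
    apply monoIdeal_congr
    intro d
    simp [wT]
  exact DL.transfer _ P _ h3 i (Nat.lt_succ_self i)
end Primary


section Conn
open IsLocalRing
variable {B : Type} [CommRing B] [IsLocalRing B]

theorem ext1_mul (h : DGE B B 2) (φ : maximalIdeal B →ₗ[B] B) :
    ∃ b : B, ∀ y : maximalIdeal B, φ y = y * b := by
  have hS := shortExact_of (maximalIdeal B).subtype (maximalIdeal B).mkQ
    (Submodule.subtype_injective _) (Submodule.mkQ_surjective _)
    (LinearMap.exact_subtype_mkQ (maximalIdeal B))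
  have := h 1 (by omega)
  obtain ⟨x, hx⟩ := Abelian.Ext.contravariant_sequence_exact₁ hS (ModuleCat.of B B)
    (Abelian.Ext.mk₀ (ModuleCat.ofHom φ)) (n₁ := 1) rfl (Subsingleton.elim (α := Abelian.Ext (ModuleCat.of B (B ⧸ maximalIdeal B)) (ModuleCat.of B B) 1) _ _)
  obtain ⟨ψ, rfl⟩ := (Abelian.Ext.mk₀_bijective _ _).2 x
  rw [Abelian.Ext.mk₀_comp_mk₀] at hx
  have hx' := (Abelian.Ext.mk₀_bijective _ _).1 hx
  refine ⟨ψ.hom 1, fun y => ?_⟩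
  have h2 : ψ.hom ((maximalIdeal B).subtype y) = φ y := 
    congrArg (fun f => f.hom y) hx'
  rw [← h2]
  have h3 := ψ.hom.map_smul (y : B) (1 : B)
  simpa using h3

theorem conn_abs (h : DGE B B 2) (J₁ J₂ : Ideal B) (hJ : J₁ ⊓ J₂ = ⊥)
    (h1 : ∀ z, (∀ y ∈ maximalIdeal B, y * z ∈ J₁) → z ∈ J₁)
    (h2 : ∀ z, (∀ y ∈ maximalIdeal B, y * z ∈ J₂) → z ∈ J₂) (f : B)
    (hf : ∀ y ∈ maximalIdeal B, y * f ∈ J₁ ⊔ J₂) : f ∈ J₁ ⊔ J₂ := by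
  have huniq : ∀ {w z z' : B}, z ∈ J₁ → z' ∈ J₁ → w - z ∈ J₂ → w - z' ∈ J₂ → z = z' := by
    intro w z z' a b c d
    have : z - z' ∈ J₁ ⊓ J₂ := ⟨sub_mem a b, by
      have := sub_mem d c
      rwa [sub_sub_sub_cancel_left] at this⟩
    rw [hJ] at this
    exact sub_eq_zero.1 this
  have hex : ∀ y : maximalIdeal B, ∃ z, z ∈ J₁ ∧ y * f - z ∈ J₂ := by
    intro y
    obtain ⟨a, ha, b, hb, hab⟩ := Submodule.mem_sup.1 (hf y y.2)
    exact ⟨a, ha, by rw [← hab]; simpa using hb⟩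
  choose c hc1 hc2 using hex
  let φ : maximalIdeal B →ₗ[B] B :=
    { toFun := c
      map_add' := by
        intro x y
        refine huniq (w := ((x + y : maximalIdeal B) : B) * f) (hc1 _) (add_mem (hc1 x) (hc1 y)) (hc2 _) ?_
        have := add_mem (hc2 x) (hc2 y)
        convert this using 1
        push_cast; ring
      map_smul' := by
        intro r x
        refine huniq (w := ((r • x : maximalIdeal B) : B) * f) (hc1 _) (Ideal.mul_mem_left _ r (hc1 x)) (hc2 _) ?_
        have := Ideal.mul_mem_left _ r (hc2 x)
        convert this using 1
        simp; ring }
  obtain ⟨b, hb⟩ := ext1_mul h φ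
  have hb' : ∀ y : maximalIdeal B, c y = y * b := hb
  have e1 : b ∈ J₁ := h1 b fun y hy => by rw [← hb' ⟨y, hy⟩]; exact hc1 _
  have e2 : f - b ∈ J₂ := h2 _ fun y hy => by
    have := hc2 ⟨y, hy⟩
    rw [hb' ⟨y, hy⟩] at this
    convert this using 1
    ring
  have := Submodule.add_mem_sup e1 e2
  simpa using this

theorem conn_abs' (h : DGE B B 2) (J₁ J₂ : Ideal B) (hJ : J₁ ⊓ J₂ = ⊥)
    (h1 : ∀ z, (∀ y ∈ maximalIdeal B, y * z ∈ J₁) → z ∈ J₁)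
    (h2 : ∀ z, (∀ y ∈ maximalIdeal B, y * z ∈ J₂) → z ∈ J₂) (f : B)
    (s : Finset B) (hs : maximalIdeal B = Ideal.span s) (m : ℕ)
    (hf : ∀ y ∈ s, y ^ m * f ∈ J₁ ⊔ J₂) : f ∈ J₁ ⊔ J₂ := by
  let L : Ideal B := Submodule.comap (LinearMap.toSpanSingleton B B f) (J₁ ⊔ J₂)
  have hL : ∀ y, y ∈ L ↔ y * f ∈ J₁ ⊔ J₂ := fun y => Iff.rfl
  have hrad : maximalIdeal B ≤ L.radical := by
    rw [hs, Ideal.span_le]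
    intro y hy
    exact ⟨m, hf y hy⟩
  obtain ⟨N, hN⟩ := Ideal.exists_pow_le_of_le_radical_of_fg hrad ⟨s, hs.symm⟩
  induction N with
  | zero =>
    rw [pow_zero, Ideal.one_eq_top] at hN
    have := hN (Submodule.mem_top (x := (1 : B)))
    rw [hL] at this
    simpa using this
  | succ N ih =>
    apply ih
    intro z hz
    rw [hL]
    apply conn_abs h J₁ J₂ hJ h1 h2
    intro y hy
    rw [← mul_assoc, ← hL]
    apply hN
    rw [pow_succ']
    exact Ideal.mul_mem_mul hy hz
end Conn


section H
open MvPolynomial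
variable {K : Type} [Field K] {n : ℕ}

/-- intersection over a set of faces -/
noncomputable def symI (K : Type) [Field K] {n : ℕ} (𝓐 : Set (Finset (Fin n))) (m : ℕ) :
    Ideal (MvPolynomial (Fin n) K) := ⨅ F, ⨅ (_ : F ∈ 𝓐), PF K F ^ m

theorem mem_symI {𝓐 : Set (Finset (Fin n))} {m : ℕ} {p : MvPolynomial (Fin n) K} :
    p ∈ symI K 𝓐 m ↔ ∀ F ∈ 𝓐, p ∈ PF K F ^ m := by
  simp [symI, Submodule.mem_iInf]

theorem symI_eq (𝓐 : Set (Finset (Fin n))) (m : ℕ) :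
    symI K 𝓐 m = monoIdeal K (wT 𝓐 m 0) := by
  ext p
  rw [mem_symI, mem_monoIdeal (upC_wT _ _ _)]
  simp only [mem_PF_pow, wT]
  simp
  tauto

theorem mem_symI_sup {𝓐 𝓐' : Set (Finset (Fin n))} {m : ℕ} {p : MvPolynomial (Fin n) K}
    (h : p ∈ symI K 𝓐 m ⊔ symI K 𝓐' m) (d : Fin n →₀ ℕ) (hd : d ∈ p.support) :
    wT 𝓐 m 0 d ∨ wT 𝓐' m 0 d := by
  obtain ⟨a, ha, b, hb, rfl⟩ := Submodule.mem_sup.1 h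
  rw [symI_eq, mem_monoIdeal (upC_wT _ _ _)] at ha hb
  classical
  rcases Finset.mem_union.1 (support_add hd) with h | h
  · exact Or.inl (ha d h)
  · exact Or.inr (hb d h)

/-- the unit killing everything outside W -/
noncomputable def s0 (K : Type) [Field K] {n : ℕ} (W : Finset (Fin n)) (m : ℕ) :
    MvPolynomial (Fin n) K := ∏ j ∈ Wᶜ, X j ^ m

theorem s0_notMem (W : Finset (Fin n)) (m : ℕ) : s0 K W m ∉ PF K W := by
  intro h
  obtain ⟨j, hj, hj'⟩ := (Ideal.IsPrime.prod_mem_iff).1 h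
  have := Ideal.IsPrime.mem_of_pow_mem inferInstance _ hj'
  rw [X_mem_PF] at this
  exact (Finset.mem_compl.1 hj) this

theorem s0_mem {W F : Finset (Fin n)} {m : ℕ} (h : ¬ F ⊆ W) : s0 K W m ∈ PF K F ^ m := by
  obtain ⟨j, hj, hjW⟩ := Finset.not_subset.1 h
  refine Ideal.mem_of_dvd _ (Finset.dvd_prod_of_mem _ (Finset.mem_compl.2 hjW)) ?_
  exact Ideal.pow_mem_pow (X_mem_PF.2 hj) _

section
variable (W : Finset (Fin n)) (I : Ideal (MvPolynomial (Fin n) K)) (B : Type) [CommRing B]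
  [Algebra (MvPolynomial (Fin n) K ⧸ I) B]

noncomputable abbrev gB : MvPolynomial (Fin n) K →+* B :=
  (algebraMap (MvPolynomial (Fin n) K ⧸ I) B).comp (Ideal.Quotient.mk I)

variable (P : Ideal (MvPolynomial (Fin n) K ⧸ I)) [P.IsPrime] [IsLocalization.AtPrime B P]

theorem gB_mem (hP : P.comap (Ideal.Quotient.mk I) = PF K W) {L : Ideal (MvPolynomial (Fin n) K)} (hL : I ≤ L) (p : MvPolynomial (Fin n) K) :
    gB I B p ∈ L.map (gB I B) ↔ ∃ s, s ∉ PF K W ∧ s * p ∈ L := by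
  have hmap : L.map (gB I B) = (L.map (Ideal.Quotient.mk I)).map (algebraMap _ B) := by
    rw [Ideal.map_map]
  have hq : ∀ q, Ideal.Quotient.mk I q ∈ L.map (Ideal.Quotient.mk I) ↔ q ∈ L := by
    intro q
    rw [Ideal.mem_quotient_iff_mem hL]
  rw [hmap]
  change algebraMap _ B (Ideal.Quotient.mk I p) ∈ _ ↔ _
  rw [IsLocalization.algebraMap_mem_map_algebraMap_iff P.primeCompl]
  constructor
  · rintro ⟨s, hs, h⟩
    obtain ⟨s, rfl⟩ := Ideal.Quotient.mk_surjective s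
    refine ⟨s, ?_, ?_⟩
    · rw [← hP]; exact hs
    · rwa [← map_mul, hq] at h
  · rintro ⟨s, hs, h⟩
    refine ⟨Ideal.Quotient.mk I s, ?_, ?_⟩
    · rw [← hP] at hs; exact hs
    · rwa [← map_mul, hq]

theorem gB_surj (I : Ideal (MvPolynomial (Fin n) K)) (B : Type) [CommRing B]
    [Algebra (MvPolynomial (Fin n) K ⧸ I) B] (P : Ideal (MvPolynomial (Fin n) K ⧸ I)) [P.IsPrime]
    [IsLocalization.AtPrime B P] (z : B) : ∃ p s, IsUnit (gB I B s) ∧ z * gB I B s = gB I B p := by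
  obtain ⟨⟨p, s⟩, h⟩ := IsLocalization.surj P.primeCompl z
  obtain ⟨p, rfl⟩ := Ideal.Quotient.mk_surjective p
  obtain ⟨s', hs'⟩ := Ideal.Quotient.mk_surjective (s : MvPolynomial (Fin n) K ⧸ I)
  refine ⟨p, s', ?_, ?_⟩
  · change IsUnit (algebraMap _ B (Ideal.Quotient.mk I s'))
    rw [hs']
    exact IsLocalization.map_units B s
  · change z * (algebraMap _ B (Ideal.Quotient.mk I s')) = _
    rw [hs']; exact h

theorem gB_symI (hP : P.comap (Ideal.Quotient.mk I) = PF K W) {𝓐 : Set (Finset (Fin n))} {m : ℕ} (hL : I ≤ symI K 𝓐 m) (p : MvPolynomial (Fin n) K) :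
    gB I B p ∈ (symI K 𝓐 m).map (gB I B) ↔ ∀ F ∈ 𝓐, F ⊆ W → p ∈ PF K F ^ m := by
  rw [gB_mem W I B P hP hL]
  constructor
  · rintro ⟨s, hs, h⟩ F hF hFW
    exact PF_primary (mem_symI.1 h F hF) (fun h => hs (PF_mono hFW h))
  · intro h
    refine ⟨s0 K W m, s0_notMem W m, mem_symI.2 fun F hF => ?_⟩
    by_cases hFW : F ⊆ W
    · exact Ideal.mul_mem_left _ _ (h F hF hFW)
    · exact Ideal.mul_mem_right _ _ (s0_mem hFW)

theorem gB_sat (hP : P.comap (Ideal.Quotient.mk I) = PF K W) {𝓐 : Set (Finset (Fin n))} {m : ℕ} (hL : I ≤ symI K 𝓐 m) 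
    (hne : W ∉ 𝓐) (z : B) (hz : ∀ i ∈ W, gB I B (X i) * z ∈ (symI K 𝓐 m).map (gB I B)) :
    z ∈ (symI K 𝓐 m).map (gB I B) := by
  obtain ⟨p, s, hs, hps⟩ := gB_surj I B P z
  rw [← Ideal.mul_unit_mem_iff_mem _ hs, hps, gB_symI W I B P hP hL]
  intro F hF hFW
  obtain ⟨i, hi, hiF⟩ := Finset.not_subset.1 (fun h => hne (by rwa [Finset.Subset.antisymm h hFW]) : ¬ W ⊆ F)
  have h1 := hz i hi
  rw [← Ideal.mul_unit_mem_iff_mem _ hs, mul_assoc, hps, ← map_mul, gB_symI W I B P hP hL] at h1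
  exact PF_primary (h1 F hF hFW) (fun h => hiF (X_mem_PF.1 h))

end

theorem exists_mono_off {W : Finset (Fin n)} {s : MvPolynomial (Fin n) K} (h : s ∉ PF K W) :
    ∃ e ∈ s.support, ∀ i ∈ W, e i = 0 := by
  rw [← pow_one (PF K W), mem_PF_pow] at h
  push Not at h
  obtain ⟨e, he, hlt⟩ := h
  refine ⟨e, he, ?_⟩
  have : ∑ i ∈ W, e i = 0 := by omega
  exact Finset.sum_eq_zero_iff.1 this

theorem H_core (𝓕 𝓐 : Set (Finset (Fin n))) (h𝓐 : 𝓐 ⊆ 𝓕) (m : ℕ) (W : Finset (Fin n)) (hW : W ∉ 𝓕)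
    (I : Ideal (MvPolynomial (Fin n) K)) (hI : I = symI K 𝓕 m)
    (P : Ideal (MvPolynomial (Fin n) K ⧸ I)) [P.IsPrime]
    (hP : P.comap (Ideal.Quotient.mk I) = PF K W)
    (h : DGE (Localization.AtPrime P) (Localization.AtPrime P) 2)
    (a : Fin n →₀ ℕ) (F G : Finset (Fin n)) (hF : F ∈ 𝓐) (hFW : F ⊆ W) (haF : ∑ i ∈ F, a i < m)
    (hG : G ∈ 𝓕 \ 𝓐) (hGW : G ⊆ W) (haG : ∑ i ∈ G, a i < m)
    (hcov : ∀ F ∈ 𝓐, F ⊆ W → ∑ i ∈ F, a i < m → ∀ G ∈ 𝓕 \ 𝓐, G ⊆ W → ∑ i ∈ G, a i < m → W ⊆ F ∪ G) :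
    False := by
  classical
  let B := Localization.AtPrime P
  have hL1 : I ≤ symI K 𝓐 m := fun p hp => mem_symI.2 fun F hF => mem_symI.1 (hI ▸ hp) F (h𝓐 hF)
  have hL2 : I ≤ symI K (𝓕 \ 𝓐) m := fun p hp => mem_symI.2 fun F hF => mem_symI.1 (hI ▸ hp) F hF.1
  have hmax : IsLocalRing.maximalIdeal B = Ideal.span ((W.image fun i => gB I B (X i) : Finset B) : Set B) := by
    have h1 : IsLocalRing.maximalIdeal B = P.map (algebraMap _ B) :=
      (IsLocalization.AtPrime.map_eq_maximalIdeal P B).symm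
    have h2 : P = (PF K W).map (Ideal.Quotient.mk I) := by
      rw [← hP, Ideal.map_comap_of_surjective _ Ideal.Quotient.mk_surjective]
    have h2' := congrArg (Ideal.map (algebraMap (MvPolynomial (Fin n) K ⧸ I) B)) h2
    rw [h1, h2', Ideal.map_map, PF, Ideal.map_span, Finset.coe_image, ← Set.image_comp]
    rfl
  have hgm : ∀ i ∈ W, gB I B (X i) ∈ IsLocalRing.maximalIdeal B := by
    intro i hi
    rw [hmax]
    exact Ideal.subset_span (by simpa using ⟨i, hi, rfl⟩)
  have key := conn_abs' h ((symI K 𝓐 m).map (gB I B)) ((symI K (𝓕 \ 𝓐) m).map (gB I B)) ?_ ?_ ?_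
    (gB I B (monomial a 1)) _ hmax m ?_
  · rw [← Ideal.map_sup, gB_mem W I B P hP (hL1.trans le_sup_left)] at key
    obtain ⟨s, hs, hmem⟩ := key
    obtain ⟨e, he, he0⟩ := exists_mono_off hs
    have hsum : ∀ A ⊆ W, ∑ i ∈ A, ((e + a) i + (0 : Fin n → ℕ) i) = ∑ i ∈ A, a i := fun A hA =>
      Finset.sum_congr rfl fun i hi => by simp [he0 i (hA hi)]
    rcases mem_symI_sup hmem (e + a) (by
      rw [mem_support_iff, coeff_mul_monomial, mul_one]; exact mem_support_iff.1 he) with h3 | h3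
    · have := h3 F hF
      rw [hsum F hFW] at this
      omega
    · have := h3 G hG
      rw [hsum G hGW] at this
      omega
  · rw [eq_bot_iff]
    rintro z ⟨hz1, hz2⟩
    obtain ⟨p, s, hs, hps⟩ := gB_surj I B P z
    change z ∈ Ideal.map _ _ at hz1
    change z ∈ Ideal.map _ _ at hz2
    rw [← Ideal.mul_unit_mem_iff_mem _ hs, hps, gB_symI W I B P hP hL1] at hz1
    rw [← Ideal.mul_unit_mem_iff_mem _ hs, hps, gB_symI W I B P hP hL2] at hz2
    have h3 : gB I B p ∈ I.map (gB I B) := by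
      have hII : I.map (gB I B) = (symI K 𝓕 m).map (gB I B) := by rw [← hI]
      rw [hII, gB_symI W I B P hP hI.le]
      intro F hF hFW
      by_cases hFA : F ∈ 𝓐
      · exact hz1 F hFA hFW
      · exact hz2 F ⟨hF, hFA⟩ hFW
    have h4 : I.map (gB I B) = ⊥ := by
      rw [eq_bot_iff, Ideal.map_le_iff_le_comap]
      intro q hq
      change algebraMap _ B (Ideal.Quotient.mk I q) = 0
      rw [Ideal.Quotient.eq_zero_iff_mem.2 hq, map_zero]
    rw [h4, ← hps, Ideal.mul_unit_mem_iff_mem _ hs] at h3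
    exact h3
  · intro z hz
    exact gB_sat W I B P hP hL1 (fun h => hW (h𝓐 h)) z fun i hi => hz _ (hgm i hi)
  · intro z hz
    exact gB_sat W I B P hP hL2 (fun h => hW h.1) z fun i hi => hz _ (hgm i hi)
  · intro y hy
    obtain ⟨i, hi, rfl⟩ := Finset.mem_image.1 hy
    rw [← map_pow, ← map_mul]
    have hmono : ∀ A : Finset (Fin n), (i ∈ A ∨ m ≤ ∑ i ∈ A, a i) → (X i ^ m * monomial a 1 : MvPolynomial (Fin n) K) ∈ PF K A ^ m := by
      rintro A (hA | hA)
      · exact Ideal.mul_mem_right _ _ (Ideal.pow_mem_pow (X_mem_PF.2 hA) _)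
      · refine Ideal.mul_mem_left _ _ ?_
        rw [mem_PF_pow]
        intro d hd
        rw [Finset.mem_singleton.1 (support_monomial_subset hd)]
        exact hA
    by_cases hall : ∀ F ∈ 𝓐, F ⊆ W → ∑ i ∈ F, a i < m → i ∈ F
    · apply Ideal.mem_sup_left
      rw [gB_symI W I B P hP hL1]
      intro F hF hFW
      apply hmono
      by_cases hlt : ∑ i ∈ F, a i < m
      · exact Or.inl (hall F hF hFW hlt)
      · right; omega
    · push Not at hall
      obtain ⟨F', hF', hFW', hlt', hi'⟩ := hall
      apply Ideal.mem_sup_right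
      rw [gB_symI W I B P hP hL2]
      intro G' hG' hGW'
      apply hmono
      by_cases hlt : ∑ i ∈ G', a i < m
      · left
        have := hcov F' hF' hFW' hlt' G' hG' hGW' hlt hi
        exact (Finset.mem_union.1 this).resolve_left hi'
      · right; omega
end H


section H3
open MvPolynomial
variable {K : Type} [Field K] {n : ℕ}

theorem comap_map_PF {I : Ideal (MvPolynomial (Fin n) K)} {F : Finset (Fin n)} (h : I ≤ PF K F) :
    ((PF K F).map (Ideal.Quotient.mk I)).comap (Ideal.Quotient.mk I) = PF K F := by
  ext x
  rw [Ideal.mem_comap, Ideal.mem_quotient_iff_mem h]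

theorem map_PF_prime {I : Ideal (MvPolynomial (Fin n) K)} {F : Finset (Fin n)} (h : I ≤ PF K F) :
    ((PF K F).map (Ideal.Quotient.mk I)).IsPrime :=
  Ideal.map_isPrime_of_surjective Ideal.Quotient.mk_surjective (by rwa [Ideal.mk_ker])

theorem map_PF_lt {I : Ideal (MvPolynomial (Fin n) K)} {F G : Finset (Fin n)} (h : I ≤ PF K F)
    (hFG : F ⊂ G) : (PF K F).map (Ideal.Quotient.mk I) < (PF K G).map (Ideal.Quotient.mk I) := by
  have hG : I ≤ PF K G := h.trans (PF_mono hFG.1)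
  refine lt_of_le_of_ne (Ideal.map_mono (PF_mono hFG.1)) fun he => ?_
  have := congrArg (Ideal.comap (Ideal.Quotient.mk I)) he
  rw [comap_map_PF h, comap_map_PF hG] at this
  obtain ⟨i, hi, hi'⟩ := Finset.exists_of_ssubset hFG
  apply hi'
  rw [← X_mem_PF (K := K), this, X_mem_PF]
  exact hi

theorem two_le_height {I : Ideal (MvPolynomial (Fin n) K)} {F W : Finset (Fin n)} (h : I ≤ PF K F)
    (hFW : F ⊆ W) (hc : F.card + 2 ≤ W.card) :
    (2 : ℕ∞) ≤ ((PF K W).map (Ideal.Quotient.mk I)).height := by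
  obtain ⟨x, hxW, hxF⟩ := Finset.exists_mem_notMem_of_card_lt_card (by omega : F.card < W.card)
  have h1 : F ⊂ insert x F := Finset.ssubset_insert hxF
  have h2 : insert x F ⊂ W := by
    refine Finset.ssubset_iff_subset_ne.2 ⟨Finset.insert_subset hxW hFW, ?_⟩
    rintro rfl
    rw [Finset.card_insert_of_notMem hxF] at hc
    omega
  have hI1 : I ≤ PF K (insert x F) := h.trans (PF_mono h1.1)
  have := map_PF_prime h
  have := map_PF_prime hI1
  have := map_PF_prime (hI1.trans (PF_mono h2.1))
  have e1 := Ideal.height_add_one_le_of_lt_of_isPrime (map_PF_lt h h1)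
  have e2 := Ideal.height_add_one_le_of_lt_of_isPrime (map_PF_lt hI1 h2)
  calc (2 : ℕ∞) = 0 + 1 + 1 := by norm_num
    _ ≤ _ := add_le_add_left (le_trans (add_le_add_left zero_le _) e1) _
    _ ≤ _ := e2

theorem H_main (Δ : SimComplex n) (m : ℕ) (hm : 1 ≤ m) (hCM : IsCohenMacaulayIdeal (coverSymbPow K Δ m))
    (W F₀ : Finset (Fin n)) (hF₀ : Δ.IsFacet F₀) (hF₀W : F₀ ⊆ W) (hc : F₀.card + 2 ≤ W.card)
    (a : Fin n → ℕ) (p : Finset (Fin n) → Prop) (F G : Finset (Fin n))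
    (hF : Δ.IsFacet F) (hpF : p F) (hFW : F ⊆ W) (haF : ∑ i ∈ F, a i < m)
    (hG : Δ.IsFacet G) (hpG : ¬ p G) (hGW : G ⊆ W) (haG : ∑ i ∈ G, a i < m) :
    ∃ F G, Δ.IsFacet F ∧ Δ.IsFacet G ∧ p F ∧ ¬ p G ∧ F ⊆ W ∧ G ⊆ W ∧ ∑ i ∈ F, a i < m ∧
      ∑ i ∈ G, a i < m ∧ ¬ W ⊆ F ∪ G := by
  by_contra hcon
  push Not at hcon
  set I := coverSymbPow K Δ m with hI
  have hIe : I = symI K {F | Δ.IsFacet F} m := rfl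
  have hI0 : I ≤ PF K F₀ := by
    intro x hx
    have := mem_symI.1 (hIe ▸ hx) F₀ hF₀
    exact Ideal.pow_le_self (by omega) this
  have hP := map_PF_prime (hI0.trans (PF_mono hF₀W))
  have hD : DGE (Localization.AtPrime ((PF K W).map (Ideal.Quotient.mk I)))
      (Localization.AtPrime ((PF K W).map (Ideal.Quotient.mk I))) 2 := by
    intro i hi
    have := hCM _ hP i (by
      rw [IsLocalization.AtPrime.ringKrullDim_eq_height ((PF K W).map (Ideal.Quotient.mk I))]
      have := two_le_height hI0 hF₀W hc
      have h2 : (i : ℕ∞) < 2 := by exact_mod_cast hi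
      exact_mod_cast h2.trans_le this)
    rwa [extGroup_subsingleton_iff] at this
  refine H_core {F | Δ.IsFacet F} {F | Δ.IsFacet F ∧ p F} (fun _ h => h.1) m W ?_ I hIe _
    (comap_map_PF (hI0.trans (PF_mono hF₀W))) hD (Finsupp.equivFunOnFinite.symm a) F G ⟨hF, hpF⟩ hFW (by simpa using haF)
    ⟨hG, fun h => hpG h.2⟩ hGW (by simpa using haG) ?_
  · intro hWf
    have := hF₀.2 W hWf.1 hF₀W
    rw [this] at hc
    omega
  · rintro F ⟨hF, hpF⟩ hFW haF G ⟨hG, hpG⟩ hGW haG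
    exact hcon F G hF hG hpF (fun h => hpG ⟨hG, h⟩) hFW hGW (by simpa using haF) (by simpa using haG)
end H3


section Comb
variable {n : ℕ}

def DirEx {n : ℕ} (D : Set (Finset (Fin n))) (σ : Finset (Fin n)) : Prop :=
  ∀ F ∈ D, ∀ G ∈ D, σ ⊆ F → σ ⊆ G → ∀ x ∈ F, x ∉ G → ∃ y ∈ G, y ∉ F ∧ insert y (F.erase x) ∈ D

theorem DirEx.extend {D : Set (Finset (Fin n))} {τ : Finset (Fin n)} (h : DirEx D τ)
    (A G : Finset (Fin n)) (hτA : τ ⊆ A) (hG : G ∈ D) (hτG : τ ⊆ G) (N : ℕ) :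
    ∀ F ∈ D, A ⊆ F → (F \ (A ∪ G)).card ≤ N → ∃ F' ∈ D, A ⊆ F' ∧ F' ⊆ A ∪ G := by
  induction N with
  | zero =>
    intro F hF hAF hc
    refine ⟨F, hF, hAF, ?_⟩
    rw [← Finset.sdiff_eq_empty_iff_subset]
    exact Finset.card_eq_zero.1 (by omega)
  | succ N ih =>
    intro F hF hAF hc
    by_cases he : F ⊆ A ∪ G
    · exact ⟨F, hF, hAF, he⟩
    · obtain ⟨x, hxF, hx⟩ := Finset.not_subset.1 he
      rw [Finset.mem_union, not_or] at hx
      obtain ⟨y, hyG, hyF, hy⟩ := h F hF G hG (hτA.trans hAF) hτG x hxF hx.2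
      refine ih _ hy ?_ ?_
      · intro a ha
        have : a ≠ x := by rintro rfl; exact hx.1 ha
        simp [this, hAF ha]
      · have : insert y (F.erase x) \ (A ∪ G) ⊆ (F \ (A ∪ G)).erase x := by
          intro a ha
          simp only [Finset.mem_sdiff, Finset.mem_insert, Finset.mem_erase, Finset.mem_union] at ha ⊢
          grind
        have h2 := Finset.card_le_card this
        rw [Finset.card_erase_of_mem (by simp [hxF, hx])] at h2
        omega

theorem DirEx.rev {D : Set (Finset (Fin n))} (h : DirEx D ∅) (r : ℕ) (hr : ∀ F ∈ D, F.card = r) :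
    RevEx D := by
  intro B₁ h1 B₂ h2 v hv hv1
  obtain ⟨F', hF', hA, hsub⟩ := h.extend (insert v (B₁ ∩ B₂)) B₁ (Finset.empty_subset _) h1
    (Finset.empty_subset _) _ B₂ h2 (by
      intro a ha
      rcases Finset.mem_insert.1 ha with rfl | ha
      · exact hv
      · exact (Finset.mem_inter.1 ha).2) le_rfl
  have hvF : v ∈ F' := hA (Finset.mem_insert_self _ _)
  have hsub' : F' ⊆ insert v B₁ := by
    intro a ha
    have := hsub ha
    simp only [Finset.mem_union, Finset.mem_insert, Finset.mem_inter] at this ⊢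
    tauto
  have hnot : ¬ B₁ ⊆ F' := by
    intro hs
    have := Finset.eq_of_subset_of_card_le hs (by rw [hr _ h1, hr _ hF'])
    exact hv1 (this ▸ hvF)
  obtain ⟨u, hu, huF⟩ := Finset.not_subset.1 hnot
  refine ⟨u, hu, fun hu2 => huF (hA (by simp [hu, hu2])), ?_⟩
  have : F' = insert v (B₁.erase u) := by
    apply Finset.eq_of_subset_of_card_le
    · intro a ha
      have := hsub' ha
      simp only [Finset.mem_insert, Finset.mem_erase] at this ⊢
      rcases this with h | h
      · exact Or.inl h
      · exact Or.inr ⟨by rintro rfl; exact huF ha, h⟩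
    · rw [Finset.card_insert_of_notMem (by simp [hv1]), Finset.card_erase_of_mem hu, hr _ h1, hr _ hF']
      have := Finset.card_pos.2 ⟨u, hu⟩
      rw [hr _ h1] at this
      omega
  rwa [← this]

theorem exists_facet {Δ : SimComplex n} {F : Finset (Fin n)} (h : F ∈ Δ.faces) :
    ∃ B, Δ.IsFacet B ∧ F ⊆ B := by
  obtain ⟨B, hFB, hB⟩ := (Set.toFinite {G | G ∈ Δ.faces}).exists_le_maximal h
  exact ⟨B, ⟨hB.1, fun G hG hBG => Finset.Subset.antisymm hBG (hB.2 hG hBG)⟩, hFB⟩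

theorem matroid_pure {Δ : SimComplex n} (h : Δ.IsMatroid) {F G : Finset (Fin n)} (hF : Δ.IsFacet F)
    (hG : Δ.IsFacet G) : F.card = G.card := by
  have key : ∀ F G, Δ.IsFacet F → Δ.IsFacet G → ¬ G.card < F.card := by
    intro F G hF hG hlt
    obtain ⟨i, _, hi, hmem⟩ := h F G hF.1 hG.1 hlt
    have := hG.2 _ hmem (Finset.subset_insert _ _)
    exact hi (this ▸ Finset.mem_insert_self _ _)
  have := key F G hF hG
  have := key G F hG hF
  omega

theorem matroid_dirEx {Δ : SimComplex n} (h : Δ.IsMatroid) : DirEx {F | Δ.IsFacet F} ∅ := by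
  intro F hF G hG _ _ x hx hxG
  have hc := matroid_pure h hF hG
  have hcx := Finset.card_erase_of_mem hx
  have hpos := Finset.card_pos.2 ⟨x, hx⟩
  obtain ⟨y, hy, hyn, hmem⟩ := h G (F.erase x) hG.1 (Δ.down_closed hF.1 (Finset.erase_subset _ _)) (by omega)
  have hyx : y ≠ x := by rintro rfl; exact hxG hy
  refine ⟨y, hy, fun h => hyn (by simp [hyx, h]), ?_⟩
  obtain ⟨B, hB, hsub⟩ := exists_facet hmem
  have : insert y (F.erase x) = B := by
    apply Finset.eq_of_subset_of_card_le hsub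
    rw [Finset.card_insert_of_notMem hyn, hcx, matroid_pure h hB hF]
    omega
  rw [this]
  exact hB

theorem matroid_of_dirEx {Δ : SimComplex n} (r : ℕ) (hr : ∀ F, Δ.IsFacet F → F.card = r)
    (h : DirEx {F | Δ.IsFacet F} ∅) : Δ.IsMatroid := by
  intro F G hF hG hlt
  obtain ⟨B₁, hB₁, hFB⟩ := exists_facet hF
  obtain ⟨B₂, hB₂, hGB⟩ := exists_facet hG
  obtain ⟨B, hB, hGB', hsub⟩ := h.extend G B₁ (Finset.empty_subset _) hB₁ (Finset.empty_subset _) _ B₂ hB₂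
    hGB le_rfl
  by_contra hcon
  push Not at hcon
  have hno : ∀ i ∈ F, i ∉ G → i ∉ B := fun i hi hiG hiB =>
    hcon i hi hiG (Δ.down_closed hB.1 (Finset.insert_subset hiB hGB'))
  have h1 : B ⊆ G ∪ (B₁ \ F) := by
    intro i hi
    have := hsub hi
    have := hno i
    simp only [Finset.mem_union, Finset.mem_sdiff] at *
    tauto
  have h2 := Finset.card_le_card h1
  have h3 := Finset.card_union_le G (B₁ \ F)
  rw [Finset.card_sdiff_of_subset hFB] at h3
  have h4 := Finset.card_le_card hFB
  rw [hr B hB] at h2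
  rw [hr B₁ hB₁] at h3 h4
  omega

/-- main inductive exchange argument -/
theorem dirEx_of_H {D : Set (Finset (Fin n))} (k : ℕ) (hk : ∀ F ∈ D, F.card = k)
    (H1 : ∀ σ : Finset (Fin n), σ.card + 2 ≤ k → ∀ p : Finset (Fin n) → Prop, ∀ F ∈ D, ∀ G ∈ D,
      σ ⊆ F → σ ⊆ G → p F → ¬ p G → ∃ F' ∈ D, ∃ G' ∈ D, σ ⊆ F' ∧ σ ⊆ G' ∧ p F' ∧ ¬ p G' ∧
        ∃ z ∈ F', z ∈ G' ∧ z ∉ σ)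
    (H2 : ∀ σ : Finset (Fin n), σ.card + 2 = k → ∀ F ∈ D, ∀ G ∈ D, σ ⊆ F → σ ⊆ G → ∀ u ∈ F, u ∉ G →
      ∃ E ∈ D, σ ⊆ E ∧ u ∈ E ∧ ∃ z ∈ E, z ∈ G ∧ z ∉ σ) (N : ℕ) :
    ∀ σ : Finset (Fin n), k ≤ σ.card + N → DirEx D σ := by
  induction N with
  | zero =>
    intro σ hσ F hF G hG hσF hσG x hx hxG
    exfalso
    have h1 := Finset.eq_of_subset_of_card_le hσF (by rw [hk F hF]; omega)
    exact hxG (hσG (h1 ▸ hx))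
  | succ N ih =>
    intro σ hσ F hF G hG hσF hσG x hx hxG
    have hxσ : x ∉ σ := fun h => hxG (hσG h)
    -- reduction when F ∩ G is bigger
    by_cases hz : ∃ z ∈ F, z ∈ G ∧ z ∉ σ
    · obtain ⟨z, hzF, hzG, hzσ⟩ := hz
      exact ih (insert z σ) (by rw [Finset.card_insert_of_notMem hzσ]; omega) F hF G hG
        (Finset.insert_subset hzF hσF) (Finset.insert_subset hzG hσG) x hx hxG
    push Not at hz
    have ihi : ∀ z, z ∉ σ → DirEx D (insert z σ) := fun z hzσ =>
      ih (insert z σ) (by rw [Finset.card_insert_of_notMem hzσ]; omega)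
    have hcF := hk F hF
    have hcG := hk G hG
    have hlt : σ.card < k := by
      by_contra hcon
      have h1 := Finset.eq_of_subset_of_card_le hσF (by omega)
      exact hxσ (h1 ▸ hx)
    -- final step
    have fin : ∀ u ∈ F, u ∉ σ → u ≠ x → (∃ H ∈ D, insert u σ ⊆ H ∧ H ⊆ insert u G) →
        ∃ y ∈ G, y ∉ F ∧ insert y (F.erase x) ∈ D := by
      rintro u hu huσ hux ⟨H, hH, hσH, hHG⟩
      obtain ⟨y, hyH, hyF, hy⟩ := ihi u huσ F hF H hH (Finset.insert_subset hu hσF) hσH x hx (by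
        intro h
        rcases Finset.mem_insert.1 (hHG h) with h | h
        · exact hux h.symm
        · exact hxG h)
      refine ⟨y, (Finset.mem_insert.1 (hHG hyH)).resolve_left ?_, hyF, hy⟩
      rintro rfl
      exact hyF hu
    -- claim a
    have ca : ∀ u, u ∉ σ → (∃ H ∈ D, σ ⊆ H ∧ u ∈ H ∧ ∃ z ∈ H, z ∈ G ∧ z ∉ σ) →
        ∃ H ∈ D, insert u σ ⊆ H ∧ H ⊆ insert u G := by
      rintro u huσ ⟨H, hH, hσH, huH, z, hzH, hzG, hzσ⟩
      obtain ⟨H', hH', hA, hsub⟩ := (ihi z hzσ).extend (insert u (insert z σ)) G (Finset.subset_insert _ _)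
        hG (Finset.insert_subset hzG hσG) _ H hH
        (Finset.insert_subset huH (Finset.insert_subset hzH hσH)) le_rfl
      refine ⟨H', hH', fun a ha => hA ?_, fun a ha => ?_⟩
      · simp only [Finset.mem_insert] at ha ⊢; tauto
      · have := hsub ha
        simp only [Finset.mem_insert, Finset.mem_union] at this ⊢
        rcases this with (h | h | h) | h
        · exact Or.inl h
        · right; rwa [h]
        · exact Or.inr (hσG h)
        · exact Or.inr h
    by_cases h1 : σ.card + 1 = k
    · -- F = σ + x, G = σ + y
      have hne : ¬ G ⊆ F := fun h => hxG ((Finset.eq_of_subset_of_card_le h (by omega)) ▸ hx)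
      obtain ⟨y, hyG, hyF⟩ := Finset.not_subset.1 hne
      refine ⟨y, hyG, hyF, ?_⟩
      have hs : insert y (F.erase x) = G := by
        have e1 : σ = F.erase x := by
          apply Finset.eq_of_subset_of_card_le
          · intro a ha
            exact Finset.mem_erase.2 ⟨by rintro rfl; exact hxσ ha, hσF ha⟩
          · rw [Finset.card_erase_of_mem hx]; omega
        rw [← e1]
        apply Finset.eq_of_subset_of_card_le (Finset.insert_subset hyG hσG)
        rw [Finset.card_insert_of_notMem (fun h => hyF (hσF h))]
        omega
      rw [hs]; exact hG
    -- choose u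
    have hcard : ((F \ σ).erase x).card = k - σ.card - 1 := by
      rw [Finset.card_erase_of_mem (by simp [hx, hxσ]), Finset.card_sdiff_of_subset hσF, hcF]
    obtain ⟨u, hu⟩ := Finset.card_pos.1 (by omega : 0 < ((F \ σ).erase x).card)
    simp only [Finset.mem_erase, Finset.mem_sdiff] at hu
    obtain ⟨hux, huF, huσ⟩ := hu
    have huG : u ∉ G := fun h => huσ (hz u huF h)
    by_cases h2 : σ.card + 2 = k
    · exact fin u huF huσ hux (ca u huσ (H2 σ h2 F hF G hG hσF hσG u huF huG))
    -- claim b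
    have cb : ∀ F' ∈ D, σ ⊆ F' → ∀ u ∈ F', u ∉ σ → ∀ v ∈ F', v ∉ σ →
        (∃ H ∈ D, σ ⊆ H ∧ u ∈ H ∧ ∃ z ∈ H, z ∈ G ∧ z ∉ σ) →
        (∃ H ∈ D, σ ⊆ H ∧ v ∈ H ∧ ∃ z ∈ H, z ∈ G ∧ z ∉ σ) := by
      intro F' hF' hσF' u hu huσ v hv hvσ hN
      obtain ⟨H, hH, hσH, hHG⟩ := ca u huσ hN
      obtain ⟨F'', hF'', hA, hsub⟩ := (ihi u huσ).extend (insert v (insert u σ)) H (Finset.subset_insert _ _)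
        hH hσH _ F' hF' (Finset.insert_subset hv (Finset.insert_subset hu hσF')) le_rfl
      refine ⟨F'', hF'', fun a ha => hA (by simp [ha]), hA (by simp), ?_⟩
      have hc : (insert v (insert u σ)).card < F''.card := by
        have e1 := Finset.card_insert_le v (insert u σ)
        have e2 := Finset.card_insert_le u σ
        rw [hk F'' hF'']
        omega
      obtain ⟨z, hzF, hzn⟩ := Finset.exists_mem_notMem_of_card_lt_card hc
      have hzH := (Finset.mem_union.1 (hsub hzF)).resolve_left hzn
      simp only [Finset.mem_insert, not_or] at hzn
      exact ⟨z, hzF, (Finset.mem_insert.1 (hHG hzH)).resolve_left hzn.2.1, hzn.2.2⟩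
    refine fin u huF huσ hux (ca u huσ ?_)
    by_contra hNu
    obtain ⟨g, hgG, hgσ⟩ := Finset.exists_mem_notMem_of_card_lt_card (by omega : σ.card < G.card)
    obtain ⟨F', hF', G', hG', hσF', hσG', ⟨w, hwF, hwσ, hNw⟩, hnG, z, hzF, hzG, hzσ⟩ :=
      H1 σ (by omega) (fun E => ∃ u ∈ E, u ∉ σ ∧ (∃ H ∈ D, σ ⊆ H ∧ u ∈ H ∧ ∃ z ∈ H, z ∈ G ∧ z ∉ σ))
        G hG F hF hσG hσF ⟨g, hgG, hgσ, G, hG, hσG, hgG, g, hgG, hgG, hgσ⟩ (by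
          rintro ⟨v, hv, hvσ, hNv⟩
          exact hNu (cb F hF hσF v hv hvσ u huF huσ hNv))
    exact hnG ⟨z, hzG, hzσ, cb F' hF' hσF' w hwF hwσ z hzF hzσ hNw⟩
end Comb


section Fin
variable {K : Type} [Field K] {n : ℕ}

theorem CM_pure (Δ : SimComplex n) (m : ℕ) (hm : 1 ≤ m) (hCM : IsCohenMacaulayIdeal (coverSymbPow K Δ m))
    (N : ℕ) : ∀ F G, Δ.IsFacet F → Δ.IsFacet G → (F ∪ G).card ≤ N → F.card = G.card := by
  induction N with
  | zero =>
    intro F G _ _ h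
    have h1 := Finset.card_le_card (Finset.subset_union_left (s₁ := F) (s₂ := G))
    have h2 := Finset.card_le_card (Finset.subset_union_right (s₁ := F) (s₂ := G))
    omega
  | succ N ih =>
    have key : ∀ F G, Δ.IsFacet F → Δ.IsFacet G → (F ∪ G).card ≤ N + 1 → ¬ F.card < G.card := by
      intro F G hF hG hc hlt
      have hFG : ¬ F ⊆ G := fun h => by
        have := hF.2 G hG.1 h
        rw [this] at hlt
        omega
      have hss : G ⊂ F ∪ G := by
        refine Finset.ssubset_iff_subset_ne.2 ⟨Finset.subset_union_right, fun h => hFG ?_⟩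
        rw [h]; exact Finset.subset_union_left
      have h2 := Finset.card_lt_card hss
      obtain ⟨F', G', hF', hG', hp, hnp, hFW, hGW, -, -, hcov⟩ := H_main (K := K) Δ m hm hCM (F ∪ G) F hF
        Finset.subset_union_left (by omega) (fun _ => 0) (fun E => E.card = F.card) F G hF rfl
        Finset.subset_union_left (by simp; omega) hG (by omega) Finset.subset_union_right (by simp; omega)
      have hlt' : (F' ∪ G').card < (F ∪ G).card :=
        Finset.card_lt_card ⟨Finset.union_subset hFW hGW, hcov⟩
      have := ih F' G' hF' hG' (by omega)
      exact hnp (by rw [← this, hp])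
    intro F G hF hG h
    have h1 := key F G hF hG h
    have h2 := key G F hG hF (by rwa [Finset.union_comm])
    omega

theorem matroid_of_CM (Δ : SimComplex n) (m : ℕ) (hm : 3 ≤ m)
    (hCM : IsCohenMacaulayIdeal (coverSymbPow K Δ m)) : Δ.IsMatroid := by
  classical
  by_cases hex : ∃ F, Δ.IsFacet F
  swap
  · intro F G hF
    obtain ⟨B, hB, _⟩ := exists_facet hF
    exact absurd ⟨B, hB⟩ hex
  obtain ⟨F₁, hF₁⟩ := hex
  have hr : ∀ F, Δ.IsFacet F → F.card = F₁.card := fun F hF =>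
    CM_pure (K := K) Δ m (by omega) hCM _ F F₁ hF hF₁ le_rfl
  have hrn : F₁.card ≤ n := by simpa using Finset.card_le_univ F₁
  let D : Set (Finset (Fin n)) := {E | Δ.IsFacet Eᶜ}
  have hk : ∀ E ∈ D, E.card = n - F₁.card := by
    intro E hE
    have h1 := hr _ hE
    rw [Finset.card_compl, Fintype.card_fin] at h1
    have := Finset.card_le_univ E
    rw [Fintype.card_fin] at this
    omega
  have hcc : ∀ E σ : Finset (Fin n), E ∈ D → σ.card + 2 ≤ n - F₁.card → Eᶜ.card + 2 ≤ σᶜ.card := by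
    intro E σ hE h
    rw [hr _ hE, Finset.card_compl, Fintype.card_fin]
    omega
  have hX : DirEx D ∅ := by
    refine dirEx_of_H (n - F₁.card) hk ?_ ?_ (n - F₁.card) ∅ (by omega)
    · intro σ hσ p F hF G hG hσF hσG hpF hpG
      obtain ⟨F', G', hF', hG', hp, hnp, hFW, hGW, -, -, hcov⟩ := H_main (K := K) Δ m (by omega) hCM σᶜ Fᶜ hF
        (Finset.compl_subset_compl.2 hσF) (hcc F σ hF hσ) (fun _ => 0) (fun E => p Eᶜ) Fᶜ Gᶜ hF (by simpa using hpF)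
        (Finset.compl_subset_compl.2 hσF) (by simp; omega) hG (by simpa using hpG)
        (Finset.compl_subset_compl.2 hσG) (by simp; omega)
      refine ⟨F'ᶜ, by simpa [D] using hF', G'ᶜ, by simpa [D] using hG', Finset.subset_compl_comm.1 hFW,
        Finset.subset_compl_comm.1 hGW, hp, hnp, ?_⟩
      obtain ⟨z, hz, hz'⟩ := Finset.not_subset.1 hcov
      simp only [Finset.mem_union, not_or, Finset.mem_compl] at hz hz' ⊢
      exact ⟨z, hz'.1, hz'.2, hz⟩
    · intro σ hσ F hF G hG hσF hσG u huF huG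
      have huσ : u ∉ σ := fun h => huG (hσG h)
      obtain ⟨c, d, hcd, hGσ⟩ := Finset.card_eq_two.1 (show (G \ σ).card = 2 by
        rw [Finset.card_sdiff_of_subset hσG, hk G hG]; omega)
      have hc : c ∈ G ∧ c ∉ σ := by
        rw [← Finset.mem_sdiff, hGσ]; simp
      have hd : d ∈ G ∧ d ∉ σ := by
        rw [← Finset.mem_sdiff, hGσ]; simp
      let a : Fin n → ℕ := fun i => (if i = u then m - 1 else 0) + (if i = c then m - 2 else 0) + (if i = d then 1 else 0)
      have hsum : ∀ E : Finset (Fin n), ∑ i ∈ E, a i = (if u ∈ E then m - 1 else 0) +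
          (if c ∈ E then m - 2 else 0) + (if d ∈ E then 1 else 0) := by
        intro E
        simp only [a, Finset.sum_add_distrib, Finset.sum_ite_eq']
      have hsumc : ∀ E : Finset (Fin n), ∑ i ∈ Eᶜ, a i = (if u ∈ E then 0 else m - 1) +
          (if c ∈ E then 0 else m - 2) + (if d ∈ E then 0 else 1) := by
        intro E
        rw [hsum]
        simp only [Finset.mem_compl, ite_not]
      obtain ⟨F', G', hF', hG', hp, hnp, hFW, hGW, hsF, hsG, hcov⟩ := H_main (K := K) Δ m (by omega) hCM σᶜ Fᶜ hF
        (Finset.compl_subset_compl.2 hσF) (hcc F σ hF hσ.le) a (fun E => E = Gᶜ) Gᶜ Fᶜ hG rfl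
        (Finset.compl_subset_compl.2 hσG) (by rw [hsumc, if_neg huG, if_pos hc.1, if_pos hd.1]; omega) hF (by
          intro h
          rw [compl_inj_iff] at h
          exact huG (h ▸ huF))
        (Finset.compl_subset_compl.2 hσF) (by rw [hsumc, if_pos huF]; split_ifs <;> omega)
      have hED : G'ᶜ ∈ D := by simpa [D] using hG'
      obtain ⟨z, hz, hz'⟩ := Finset.not_subset.1 hcov
      rw [hp] at hz'
      simp only [Finset.mem_union, not_or, Finset.mem_compl, not_not] at hz hz'
      have hσE : σ ⊆ G'ᶜ := Finset.subset_compl_comm.1 hGW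
      refine ⟨G'ᶜ, hED, hσE, ?_, z, Finset.mem_compl.2 hz'.2, hz'.1, hz⟩
      by_contra hu
      have hsG' := hsG
      rw [← compl_compl G', hsumc, if_neg hu] at hsG'
      have hboth : c ∈ G'ᶜ ∧ d ∈ G'ᶜ := by
        by_cases h1 : c ∈ G'ᶜ
        · by_cases h2 : d ∈ G'ᶜ
          · exact ⟨h1, h2⟩
          · rw [if_pos h1, if_neg h2] at hsG'; omega
        · by_cases h2 : d ∈ G'ᶜ
          · rw [if_neg h1, if_pos h2] at hsG'; omega
          · rw [if_neg h1, if_neg h2] at hsG'; omega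
      apply hnp
      rw [eq_compl_comm]
      apply Finset.eq_of_subset_of_card_le
      · intro i hi
        by_cases his : i ∈ σ
        · exact hσE his
        · have : i ∈ G \ σ := Finset.mem_sdiff.2 ⟨hi, his⟩
          rw [hGσ] at this
          rcases Finset.mem_insert.1 this with h | h
          · rw [h]; exact hboth.1
          · rw [Finset.mem_singleton.1 h]; exact hboth.2
      · rw [hk _ hED, hk G hG]
  have hRev := hX.rev _ hk
  refine matroid_of_dirEx F₁.card hr ?_
  intro F hF G hG _ _ x hx hxG
  obtain ⟨u, hu, hu2, hmem⟩ := hRev Fᶜ (by simpa [D] using hF) Gᶜ (by simpa [D] using hG) x (by simpa using hxG)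
    (by simpa using hx)
  simp only [Finset.mem_compl, not_not] at hu hu2
  refine ⟨u, hu2, hu, ?_⟩
  have hux : u ≠ x := by rintro rfl; exact hu hx
  have : (insert x (Fᶜ.erase u))ᶜ = insert u (F.erase x) := by
    ext i
    simp only [Finset.mem_compl, Finset.mem_insert, Finset.mem_erase, not_or, not_and, not_not]
    grind
  change Δ.IsFacet _ at hmem
  rw [this] at hmem
  exact hmem
end Fin


/-- **Theorem.** For a simplicial complex `Δ` on `[n]` with cover ideal
`J(Δ) = ⋂_{F facet} P_F`: all symbolic powers of `J(Δ)` are Cohen–Macaulay iff some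
symbolic power `J(Δ)^{(m)}`, `m ≥ 3`, is Cohen–Macaulay iff `Δ` is a matroid. -/
theorem cover_ideal_symbolic_powers_CM_iff_matroid (K : Type) [Field K] {n : ℕ}
    (Δ : SimComplex n)
    (hV : ∀ i : Fin n, ({i} : Finset (Fin n)) ∈ Δ.faces) :
    List.TFAE
      [∀ m : ℕ, 1 ≤ m → IsCohenMacaulayIdeal (coverSymbPow K Δ m),
       ∃ m : ℕ, 3 ≤ m ∧ IsCohenMacaulayIdeal (coverSymbPow K Δ m),
       Δ.IsMatroid] := by
  tfae_have 1 → 2 := fun h => ⟨3, le_rfl, h 3 (by norm_num)⟩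
  tfae_have 2 → 3 := fun ⟨m, hm, h⟩ => matroid_of_CM Δ m hm h
  tfae_have 3 → 1 := by
    intro h m _
    by_cases hex : ∃ F, Δ.IsFacet F
    · obtain ⟨F₁, hF₁⟩ := hex
      have hr : ∀ F, Δ.IsFacet F → F.card = F₁.card := fun F hF => matroid_pure h hF hF₁
      exact CM_of_revEx Δ F₁.card hr ((matroid_dirEx h).rev F₁.card hr) m
    · refine CM_of_revEx Δ 0 (fun F hF => absurd ⟨F, hF⟩ hex) ?_ m
      intro F hF
      exact absurd ⟨F, hF⟩ hex
  tfae_finish
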